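/- arXiv:2410.15867 — 2 statements merged into one kernel-verified Lean document; each statement's English description precedes it below -/
import Mathlib

section
/- Assume (A1)–(A4) and that there exist d₁,…,d_n > 0 with β_i > Σ_{j=1}^{n} [(|c_{ij}(t)| + |d_{ij}(t)|)·μ_j·ρ_j·(d_j/d_i) + Σ_{l=1}^{n} |e_{ijl}(t)|·((d_j/d_i)·M_l·μ_j·ρ_j + (d_l/d_i)·M_j·μ_l·ρ_l)] for all t ∈ [0,ω] and all i. Let ĉ_{ij}, d̂_{ij}, ê_{ijl}, Î_i : [0,∞) → ℝ be continuous with c_{ij}(t)−ĉ_{ij}(t) → 0, d_{ij}(t)−d̂_{ij}(t) → 0, e_{ijl}(t)−ê_{ijl}(t) → 0, I_i(t)−Î_i(t) → 0 as t → +∞, and let (M̂) be the system obtained from (M) by replacing c_{ij}, d_{ij}, e_{ijl}, I_i with ĉ_{ij}, d̂_{ij}, ê_{ijl}, Î_i. If in addition there exist d*₁,…,d*_n > 0 such that for all t ∈ [0,ω] and all i: a̲_i·β_i > Σ_{j=1}^{n} [(|c_{ij}(t)| + |d_{ij}(t)|)·μ_j·ρ_j·ā_j·(d*_j/d*_i)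 + Σ_{l=1}^{n} |e_{ijl}(t)|·((d*_j/d*_i)·ā_j·M_l·μ_j·ρ_j + (d*_l/d*_i)·ā_l·M_j·μ_l·ρ_l)], then there exists an ω-periodic solution x̃ of (M) (continuous ω-periodic, differentiable, satisfying (M) for t > 0) such that every solution x̂ of (M̂) with bounded initial condition (continuous on ℝ, bounded on (−∞,t₀] for some t₀ ≥ 0, differentiable on (t₀,∞), satisfying (M̂) for t > t₀) verifies lim_{t→+∞} |x̂(t) − x̃(t)| = 0 in the max norm. -/
open MeasureTheory Filter

/-- Right-hand side of the high-order Cohen--Grossberg model (M). -/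
noncomputable def Mrhs (n : ℕ) (ρc : Fin (n+1) → ℝ) (a b : Fin (n+1) → ℝ → ℝ)
    (c d : Fin (n+1) → Fin (n+1) → ℝ → ℝ) (e : Fin (n+1) → Fin (n+1) → Fin (n+1) → ℝ → ℝ)
    (I : Fin (n+1) → ℝ → ℝ) (f : Fin (n+1) → ℝ → ℝ) (K : Fin (n+1) → Fin (n+1) → ℝ → ℝ)
    (x : Fin (n+1) → ℝ → ℝ) (i : Fin (n+1)) (t : ℝ) : ℝ :=
  a i (x i t) * (-(b i (x i t))
    + (∑ j : Fin (n+1), c i j t * f j (ρc j * x j t))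
    + (∑ j : Fin (n+1), d i j t * f j (ρc j * ∫ u in Set.Ioi (0:ℝ), K i j u * x j (t - u)))
    + (∑ j : Fin (n+1), ∑ l : Fin (n+1), e i j l t
        * f j (ρc j * ∫ u in Set.Ioi (0:ℝ), K i j u * x j (t - u))
        * f l (ρc l * ∫ u in Set.Ioi (0:ℝ), K i l u * x l (t - u)))
    + I i t)

/-- A solution of (M) on `ℝ` with bounded initial condition at `t₀`. -/
def MIsSolution (n : ℕ) (ρc : Fin (n+1) → ℝ) (a b : Fin (n+1) → ℝ → ℝ)
    (c d : Fin (n+1) → Fin (n+1) → ℝ → ℝ) (e : Fin (n+1) → Fin (n+1) → Fin (n+1) → ℝ → ℝ)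
    (I : Fin (n+1) → ℝ → ℝ) (f : Fin (n+1) → ℝ → ℝ) (K : Fin (n+1) → Fin (n+1) → ℝ → ℝ)
    (t₀ : ℝ) (x : Fin (n+1) → ℝ → ℝ) : Prop :=
  (∀ i, Continuous (x i)) ∧
  (∃ M, ∀ i, ∀ t ≤ t₀, |x i t| ≤ M) ∧
  (∀ i, ∀ t, t₀ < t → HasDerivAt (x i) (Mrhs n ρc a b c d e I f K x i t) t)

/-- Standing regularity assumptions on the data of model (M). -/
def MRegular (n : ℕ) (ρc : Fin (n+1) → ℝ) (a b : Fin (n+1) → ℝ → ℝ)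
    (c d : Fin (n+1) → Fin (n+1) → ℝ → ℝ) (e : Fin (n+1) → Fin (n+1) → Fin (n+1) → ℝ → ℝ)
    (I : Fin (n+1) → ℝ → ℝ) (f : Fin (n+1) → ℝ → ℝ)
    (K : Fin (n+1) → Fin (n+1) → ℝ → ℝ) : Prop :=
  (∀ j, 0 < ρc j) ∧
  (∀ i, Continuous (a i)) ∧ (∀ i u, 0 < a i u) ∧
  (∀ i, Continuous (b i)) ∧
  (∀ i j, ContinuousOn (c i j) (Set.Ici 0)) ∧
  (∀ i j, ContinuousOn (d i j) (Set.Ici 0)) ∧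
  (∀ i j l, ContinuousOn (e i j l) (Set.Ici 0)) ∧
  (∀ i, ContinuousOn (I i) (Set.Ici 0)) ∧
  (∀ j, Continuous (f j)) ∧
  (∀ i j, ContinuousOn (K i j) (Set.Ici 0)) ∧
  (∀ i j, ∀ u ≥ (0:ℝ), 0 ≤ K i j u) ∧
  (∀ i j, ∫ u in Set.Ioi (0:ℝ), K i j u = 1)

/-- Assumptions (A1)-(A4) on model (M). -/
def MAssumptions (n : ℕ) (ω : ℝ) (ρc : Fin (n+1) → ℝ) (a b : Fin (n+1) → ℝ → ℝ)
    (c d : Fin (n+1) → Fin (n+1) → ℝ → ℝ) (e : Fin (n+1) → Fin (n+1) → Fin (n+1) → ℝ → ℝ)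
    (I : Fin (n+1) → ℝ → ℝ) (f : Fin (n+1) → ℝ → ℝ)
    (aL aU β βs M μ : Fin (n+1) → ℝ) : Prop :=
  -- (A1) ω-periodicity of the coefficients
  (∀ i j, ∀ t ≥ (0:ℝ), c i j (t + ω) = c i j t) ∧
  (∀ i j, ∀ t ≥ (0:ℝ), d i j (t + ω) = d i j t) ∧
  (∀ i j l, ∀ t ≥ (0:ℝ), e i j l (t + ω) = e i j l t) ∧
  (∀ i, ∀ t ≥ (0:ℝ), I i (t + ω) = I i t) ∧
  -- (A2)
  (∀ i, 0 < aL i) ∧ (∀ i, aL i ≤ aU i) ∧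
  (∀ i, ∀ u : ℝ, aL i ≤ a i u ∧ a i u ≤ aU i) ∧
  -- (A3)
  (∀ i, 0 < β i) ∧ (∀ i, 0 < βs i) ∧
  (∀ i, ∀ u v : ℝ, u ≠ v → β i ≤ (b i u - b i v) / (u - v) ∧ (b i u - b i v) / (u - v) ≤ βs i) ∧
  -- (A4)
  (∀ i, 0 < M i) ∧ (∀ i, 0 < μ i) ∧
  (∀ i, ∀ u v : ℝ, |f i u - f i v| ≤ μ i * |u - v|) ∧
  (∀ i, ∀ u : ℝ, |f i u| ≤ M i)

section ScalarLemmas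

/-- The change of variables `A = ∫ 1 / a` and its inverse. -/
theorem exists_inverse_primitive {a : ℝ → ℝ} (ha : Continuous a) {l U : ℝ} (hl : 0 < l)
    (h : ∀ u, l ≤ a u ∧ a u ≤ U) :
    ∃ A φ : ℝ → ℝ, (∀ x, φ (A x) = x) ∧ (∀ u, A (φ u) = u) ∧
      (∀ x, HasDerivAt A (a x)⁻¹ x) ∧ (∀ u, HasDerivAt φ (a (φ u)) u) := by
  have hpos : ∀ u, 0 < a u := fun u => hl.trans_le (h u).1
  have hinv : Continuous fun u => (a u)⁻¹ := ha.inv₀ fun u => (hpos u).ne'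
  set A : ℝ → ℝ := fun x => ∫ s in (0 : ℝ)..x, (a s)⁻¹ with hA
  have hd : ∀ x, HasDerivAt A (a x)⁻¹ x := fun x =>
    intervalIntegral.integral_hasDerivAt_right (hinv.intervalIntegrable _ _)
      (hinv.stronglyMeasurableAtFilter _ _) hinv.continuousAt
  have hmono : StrictMono A := strictMono_of_deriv_pos fun x => by
    rw [(hd x).deriv]; exact inv_pos.2 (hpos x)
  have hU : 0 < U := (hpos 0).trans_le (h 0).2
  have hA0 : A 0 = 0 := by simp [hA]
  have hd' : ∀ x, HasDerivAt (fun x => A x - U⁻¹ * x) ((a x)⁻¹ - U⁻¹ * 1) x := fun x =>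
    (hd x).sub ((hasDerivAt_id x).const_mul _)
  have hm : Monotone fun x => A x - U⁻¹ * x := by
    refine monotone_of_deriv_nonneg (fun x => (hd' x).differentiableAt) fun x => ?_
    rw [(hd' x).deriv, mul_one, sub_nonneg]
    exact inv_anti₀ (hpos x) (h x).2
  have hcont : Continuous A := continuous_iff_continuousAt.2 fun x => (hd x).continuousAt
  have hsurj : Function.Surjective A := by
    refine hcont.surjective ?_ ?_
    · refine tendsto_atTop_mono' atTop ?_ (tendsto_id.const_mul_atTop (inv_pos.2 hU))
      filter_upwards [eventually_ge_atTop 0] with x hx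
      have := hm hx
      simp only [hA0, mul_zero, sub_zero] at this
      simpa using this
    · refine tendsto_atBot_mono' atBot ?_ (tendsto_id.const_mul_atBot (inv_pos.2 hU))
      filter_upwards [eventually_le_atBot 0] with x hx
      have := hm hx
      simp only [hA0, mul_zero, sub_zero] at this
      simpa using this
  let F : ℝ ≃o ℝ := hmono.orderIsoOfSurjective A hsurj
  have hF : ∀ x, F x = A x := fun x => rfl
  have hright : ∀ u, A (F.symm u) = u := fun u => by rw [← hF, F.apply_symm_apply]
  refine ⟨A, F.symm, fun x => by rw [← hF, F.symm_apply_apply], hright, hd, fun u => ?_⟩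
  have := HasDerivAt.of_local_left_inverse (F.symm.continuous.continuousAt (x := u))
    (hd (F.symm u)) (inv_ne_zero (hpos _).ne') (Eventually.of_forall hright)
  simpa using this

theorem exists_slope_mem {a φ : ℝ → ℝ} {l U : ℝ} (h : ∀ u, l ≤ a u ∧ a u ≤ U)
    (hφ : ∀ u, HasDerivAt φ (a (φ u)) u) (u v : ℝ) :
    ∃ s, l ≤ s ∧ s ≤ U ∧ φ u - φ v = s * (u - v) := by
  wlog huv : v < u generalizing u v
  · rcases eq_or_lt_of_le (not_lt.1 huv) with rfl | hlt
    · exact ⟨a 0, (h 0).1, (h 0).2, by simp⟩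
    · obtain ⟨s, h1, h2, h3⟩ := this v u hlt
      exact ⟨s, h1, h2, by linarith⟩
  obtain ⟨c, -, hc⟩ := exists_hasDerivAt_eq_slope φ (fun u => a (φ u)) huv
    (fun x _ => (hφ x).continuousAt.continuousWithinAt) (fun x _ => hφ x)
  refine ⟨a (φ c), (h _).1, (h _).2, ?_⟩
  rw [hc, div_mul_cancel₀ _ (sub_pos.2 huv).ne']

theorem abs_sub_le_of_slope {a φ : ℝ → ℝ} {l U : ℝ} (hl : 0 < l) (h : ∀ u, l ≤ a u ∧ a u ≤ U)
    (hφ : ∀ u, HasDerivAt φ (a (φ u)) u) (u v : ℝ) : |φ u - φ v| ≤ U * |u - v| := by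
  obtain ⟨s, h1, h2, h3⟩ := exists_slope_mem h hφ u v
  rw [h3, abs_mul, abs_of_pos (hl.trans_le h1)]
  gcongr

theorem abs_mul_sub_comp_le {a b φ : ℝ → ℝ} {l U β β' lam : ℝ} (hl : 0 < l)
    (h : ∀ u, l ≤ a u ∧ a u ≤ U) (hφ : ∀ u, HasDerivAt φ (a (φ u)) u) (hβ : 0 < β)
    (hb : ∀ u v : ℝ, u ≠ v → β ≤ (b u - b v) / (u - v) ∧ (b u - b v) / (u - v) ≤ β')
    (hlam : U * β' ≤ lam) (u v : ℝ) :
    |lam * (u - v) - (b (φ u) - b (φ v))| ≤ (lam - l * β) * |u - v| := by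
  obtain ⟨s, h1, h2, h3⟩ := exists_slope_mem h hφ u v
  by_cases huv : u = v
  · simp [huv]
  have hs : 0 < s := hl.trans_le h1
  have hne : φ u ≠ φ v := by
    rw [← sub_ne_zero, h3]
    exact mul_ne_zero hs.ne' (sub_ne_zero.2 huv)
  obtain ⟨hq1, hq2⟩ := hb _ _ hne
  set q := (b (φ u) - b (φ v)) / (φ u - φ v) with hq
  have hbq : b (φ u) - b (φ v) = q * s * (u - v) := by
    rw [mul_assoc, ← h3, hq, div_mul_cancel₀ _ (sub_ne_zero.2 hne)]
  have h4 : l * β ≤ q * s := by nlinarith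
  have h5 : q * s ≤ lam := by nlinarith
  rw [hbq, ← sub_mul, abs_mul, abs_of_nonneg (by linarith)]
  gcongr

theorem le_exp_of_hasDerivAt {D p : ℝ → ℝ} {lam P T₀ T : ℝ} (hlam : 0 < lam) (hT : T₀ ≤ T)
    (hc : Continuous D)
    (hD : ∀ t ∈ Set.Ioo T₀ T, HasDerivAt D (-lam * D t + p t) t)
    (hp : ∀ t ∈ Set.Ioo T₀ T, p t ≤ P) :
    D T ≤ Real.exp (-lam * (T - T₀)) * (D T₀ - P / lam) + P / lam := by
  have hder : ∀ t ∈ Set.Ioo T₀ T, HasDerivAt (fun t => Real.exp (lam * t) * (D t - P / lam))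
      (Real.exp (lam * t) * (p t - P)) t := fun t ht => by
    have h1 : HasDerivAt (fun t => Real.exp (lam * t)) (Real.exp (lam * t) * (lam * 1)) t :=
      ((hasDerivAt_id t).const_mul lam).exp
    refine (h1.mul ((hD t ht).sub_const (P / lam))).congr_deriv ?_
    field_simp
    ring
  have hanti : AntitoneOn (fun t => Real.exp (lam * t) * (D t - P / lam)) (Set.Icc T₀ T) := by
    refine antitoneOn_of_deriv_nonpos (convex_Icc _ _) (by fun_prop) ?_ ?_
    · rw [interior_Icc]
      exact fun t ht => (hder t ht).differentiableAt.differentiableWithinAt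
    · rw [interior_Icc]
      intro t ht
      rw [(hder t ht).deriv]
      exact mul_nonpos_of_nonneg_of_nonpos (Real.exp_pos _).le (sub_nonpos.2 (hp t ht))
  have h1 := hanti (Set.left_mem_Icc.2 hT) (Set.right_mem_Icc.2 hT) hT
  have h2 : Real.exp (-lam * (T - T₀)) = Real.exp (lam * T₀) / Real.exp (lam * T) := by
    rw [← Real.exp_sub]; congr 1; ring
  rw [h2, div_mul_eq_mul_div, ← sub_le_iff_le_add, le_div_iff₀ (Real.exp_pos _)]
  linarith

/-- Variation of constants bound for a scalar linear equation. -/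
theorem abs_le_exp_of_hasDerivAt {D p : ℝ → ℝ} {lam P T₀ T : ℝ} (hlam : 0 < lam) (hP : 0 ≤ P)
    (hT : T₀ ≤ T) (hc : Continuous D)
    (hD : ∀ t ∈ Set.Ioo T₀ T, HasDerivAt D (-lam * D t + p t) t)
    (hp : ∀ t ∈ Set.Ioo T₀ T, |p t| ≤ P) :
    |D T| ≤ Real.exp (-lam * (T - T₀)) * |D T₀| + P / lam := by
  have hPl : 0 ≤ P / lam := by positivity
  have hE := Real.exp_pos (-lam * (T - T₀))
  have h1 := le_exp_of_hasDerivAt hlam hT hc hD fun t ht => (abs_le.1 (hp t ht)).2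
  have h2 := le_exp_of_hasDerivAt (D := fun t => -D t) (p := fun t => -p t) hlam hT hc.neg
    (fun t ht => (hD t ht).neg.congr_deriv (by ring)) fun t ht => neg_le.1 (abs_le.1 (hp t ht)).1
  have h3 := mul_le_mul_of_nonneg_left (le_abs_self (D T₀)) hE.le
  have h4 := mul_le_mul_of_nonneg_left (neg_le_abs (D T₀)) hE.le
  have h5 := mul_nonneg hE.le hPl
  rw [abs_le]
  constructor <;> linarith

theorem abs_le_div_of_hasDerivAt {D p : ℝ → ℝ} {lam P C : ℝ} (hlam : 0 < lam)
    (hC : ∀ t, |D t| ≤ C) (hD : ∀ t, HasDerivAt D (-lam * D t + p t) t)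
    (hp : ∀ t, |p t| ≤ P) (t : ℝ) : |D t| ≤ P / lam := by
  have hc : Continuous D := continuous_iff_continuousAt.2 fun x => (hD x).continuousAt
  have hlim : Tendsto (fun s : ℝ => Real.exp (-(lam * s)) * C + P / lam) atTop
      (nhds (0 * C + P / lam)) :=
    ((Real.tendsto_exp_neg_atTop_nhds_zero.comp
      (tendsto_id.const_mul_atTop hlam)).mul_const C).add_const _
  rw [zero_mul, zero_add] at hlim
  refine ge_of_tendsto hlim ?_
  filter_upwards [eventually_ge_atTop 0] with s hs
  have h1 := abs_le_exp_of_hasDerivAt (T₀ := t - s) (T := t) hlam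
    ((abs_nonneg _).trans (hp 0)) (by linarith) hc (fun t _ => hD t) fun t _ => hp t
  have h2 := mul_le_mul_of_nonneg_left (hC (t - s)) (Real.exp_pos (-lam * (t - (t - s)))).le
  rw [show -(lam * s) = -lam * (t - (t - s)) by ring]
  linarith

theorem exists_bounded_solution {h : ℝ → ℝ} {lam P : ℝ} (hlam : 0 < lam) (hc : Continuous h)
    (hP : ∀ t, |h t| ≤ P) :
    ∃ v : ℝ → ℝ, (∃ C, ∀ t, |v t| ≤ C) ∧ ∀ t, HasDerivAt v (-lam * v t + h t) t := by
  set g : ℝ → ℝ := fun s => Real.exp (lam * s) * h s with hg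
  have hgc : Continuous g := by fun_prop
  have hint : ∀ t, IntegrableOn g (Set.Iic t) := fun t => by
    refine Integrable.mono' ((integrableOn_exp_mul_Iic hlam t).mul_const P)
      hgc.aestronglyMeasurable (Eventually.of_forall fun s => ?_)
    rw [hg, Real.norm_eq_abs, abs_mul, abs_of_pos (Real.exp_pos _)]
    exact mul_le_mul_of_nonneg_left (hP s) (Real.exp_pos _).le
  set w : ℝ → ℝ := fun t => ∫ s in Set.Iic t, g s with hw
  have hwd : ∀ t, HasDerivAt w (g t) t := fun t => by
    have h1 : w = fun t => (∫ s in Set.Iic (0 : ℝ), g s) + ∫ s in (0 : ℝ)..t, g s := by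
      funext t
      rw [← intervalIntegral.integral_Iic_sub_Iic (hint 0) (hint t)]
      simp [hw]
    rw [h1]
    exact (intervalIntegral.integral_hasDerivAt_right (hgc.intervalIntegrable _ _)
      (hgc.stronglyMeasurableAtFilter _ _) hgc.continuousAt).const_add _
  refine ⟨fun t => Real.exp (-lam * t) * w t, ⟨P / lam, fun t => ?_⟩, fun t => ?_⟩
  · have h1 : |w t| ≤ ∫ s in Set.Iic t, Real.exp (lam * s) * P := by
      rw [hw, ← Real.norm_eq_abs]
      refine norm_integral_le_of_norm_le ((integrableOn_exp_mul_Iic hlam t).mul_const P)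
        (Eventually.of_forall fun s => ?_)
      rw [hg, Real.norm_eq_abs, abs_mul, abs_of_pos (Real.exp_pos _)]
      exact mul_le_mul_of_nonneg_left (hP s) (Real.exp_pos _).le
    rw [integral_mul_const, integral_exp_mul_Iic hlam] at h1
    rw [abs_mul, abs_of_pos (Real.exp_pos _)]
    refine (mul_le_mul_of_nonneg_left h1 (Real.exp_pos _).le).trans_eq ?_
    have : Real.exp (-lam * t) * Real.exp (lam * t) = 1 := by
      rw [← Real.exp_add]; simp
    linear_combination (P / lam) * this
  · have h1 : HasDerivAt (fun t => Real.exp (-lam * t)) (Real.exp (-lam * t) * (-lam * 1)) t :=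
      ((hasDerivAt_id t).const_mul (-lam)).exp
    refine (h1.mul (hwd t)).congr_deriv ?_
    have : Real.exp (-lam * t) * Real.exp (lam * t) = 1 := by
      rw [← Real.exp_add]; simp
    rw [hg]
    linear_combination h t * this

theorem exists_periodic_extension {c : ℝ → ℝ} {ω : ℝ} (hω : 0 < ω)
    (hc : ContinuousOn c (Set.Ici 0)) (hper : ∀ t ≥ (0 : ℝ), c (t + ω) = c t) :
    ∃ g : ℝ → ℝ, Continuous g ∧ Function.Periodic g ω ∧ ∀ t ≥ (0 : ℝ), g t = c t := by
  have : Fact (0 < ω) := ⟨hω⟩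
  have hP : Function.Periodic (fun t : ℝ => AddCircle.liftIco ω 0 c (t : AddCircle ω)) ω :=
    fun t => by simp only [AddCircle.coe_add_period]
  refine ⟨fun t => AddCircle.liftIco ω 0 c (t : AddCircle ω), ?_, hP, fun t ht => ?_⟩
  · refine (AddCircle.liftIco_continuous (by rw [hper 0 le_rfl])
      (hc.mono fun x hx => hx.1)).comp (AddCircle.continuous_mk' ω)
  · have hnat : ∀ (m : ℕ) (s : ℝ), 0 ≤ s → c (s + m * ω) = c s := by
      intro m
      induction m with
      | zero => intro s _; simp
      | succ k ih =>
        intro s hs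
        rw [← ih s hs, ← hper (s + k * ω) (by positivity)]
        congr 1; push_cast; ring
    have hm : ((⌊t / ω⌋₊ : ℕ) : ℝ) * ω ≤ t := by
      rw [← le_div_iff₀ hω]; exact Nat.floor_le (by positivity)
    have hm' : t < ((⌊t / ω⌋₊ : ℕ) + 1 : ℝ) * ω := by
      rw [← div_lt_iff₀ hω]; exact Nat.lt_floor_add_one _
    set m := ⌊t / ω⌋₊
    have e : t = (t - m * ω) + m * ω := by ring
    have h1 := (hP.nat_mul m) (t - m * ω)
    rw [← e] at h1
    refine h1.trans ?_
    conv_rhs => rw [e, hnat m _ (by linarith)]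
    exact AddCircle.liftIco_coe_apply ⟨by linarith, by linarith⟩

theorem exists_uniform_gap {ι : Type*} [Finite ι] [Nonempty ι] {S : ι → ℝ → ℝ} {B : ι → ℝ}
    {ω : ℝ} (hω : 0 < ω) (hS : ∀ i, Continuous (S i)) (hper : ∀ i, Function.Periodic (S i) ω)
    (h : ∀ i, ∀ t ∈ Set.Icc (0 : ℝ) ω, S i t < B i) :
    ∃ δ > 0, ∀ i t, S i t ≤ B i - δ := by
  have h1 : ∀ i, ∃ τ ∈ Set.Icc (0 : ℝ) ω, ∀ t ∈ Set.Icc (0 : ℝ) ω, S i t ≤ S i τ := fun i =>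
    isCompact_Icc.exists_isMaxOn ⟨0, le_rfl, hω.le⟩ (hS i).continuousOn
  choose τ hτ hmax using h1
  obtain ⟨i₀, hi₀⟩ := Finite.exists_min fun i => B i - S i (τ i)
  refine ⟨B i₀ - S i₀ (τ i₀), sub_pos.2 (h _ _ (hτ _)), fun i t => ?_⟩
  obtain ⟨s, hs, hst⟩ := (hper i).exists_mem_Ico₀ hω t
  have h2 := hmax i s ⟨hs.1, hs.2.le⟩
  have h3 := hi₀ i
  rw [hst]
  linarith

end ScalarLemmas

section Delay

variable {K x y D : ℝ → ℝ} {t C : ℝ}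

theorem integrableOn_delay (hK : IntegrableOn K (Set.Ioi 0)) (hx : Continuous x)
    (hC : ∀ s ≤ t, |x s| ≤ C) : IntegrableOn (fun u => K u * x (t - u)) (Set.Ioi 0) := by
  refine Integrable.mono' (hK.norm.mul_const C)
    (hK.aestronglyMeasurable.mul (by fun_prop : Continuous fun u => x (t - u)).aestronglyMeasurable)
    ((ae_restrict_iff' measurableSet_Ioi).2 (Eventually.of_forall fun u hu => ?_))
  rw [norm_mul]
  exact mul_le_mul_of_nonneg_left (hC _ (by linarith [Set.mem_Ioi.1 hu])) (norm_nonneg _)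

theorem integral_delay_abs_le (hK : IntegrableOn K (Set.Ioi 0)) (hK0 : ∀ u ≥ (0 : ℝ), 0 ≤ K u)
    (hK1 : ∫ u in Set.Ioi (0 : ℝ), K u = 1) (hx : Continuous x)
    (hC : ∀ s ≤ t, |x s| ≤ C) : ∫ u in Set.Ioi (0 : ℝ), K u * |x (t - u)| ≤ C := by
  calc ∫ u in Set.Ioi (0 : ℝ), K u * |x (t - u)| ≤ ∫ u in Set.Ioi (0 : ℝ), K u * C := by
        refine setIntegral_mono_on
          (integrableOn_delay (x := fun s => |x s|) (C := C) hK hx.abs fun s hs => ?_)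
          (hK.mul_const C) measurableSet_Ioi fun u hu => ?_
        · rw [abs_abs]; exact hC s hs
        · have hu' : (0 : ℝ) < u := hu
          exact mul_le_mul_of_nonneg_left (hC _ (by linarith)) (hK0 u hu'.le)
    _ = C := by rw [integral_mul_const, hK1, one_mul]

theorem abs_delay_sub_le {m : ℝ} (hK : IntegrableOn K (Set.Ioi 0))
    (hK0 : ∀ u ≥ (0 : ℝ), 0 ≤ K u) (hx : Continuous x) (hy : Continuous y) (hD : Continuous D)
    (hxC : ∃ C, ∀ s ≤ t, |x s| ≤ C) (hyC : ∃ C, ∀ s ≤ t, |y s| ≤ C)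
    (hDC : ∃ C, ∀ s ≤ t, |D s| ≤ C) (h : ∀ s ≤ t, |x s - y s| ≤ m * |D s|) :
    |(∫ u in Set.Ioi (0 : ℝ), K u * x (t - u)) - ∫ u in Set.Ioi (0 : ℝ), K u * y (t - u)|
      ≤ m * ∫ u in Set.Ioi (0 : ℝ), K u * |D (t - u)| := by
  obtain ⟨Cx, hCx⟩ := hxC
  obtain ⟨Cy, hCy⟩ := hyC
  obtain ⟨Cd, hCd⟩ := hDC
  rw [← integral_sub (integrableOn_delay hK hx hCx) (integrableOn_delay hK hy hCy),
    ← integral_const_mul, ← Real.norm_eq_abs]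
  refine norm_integral_le_of_norm_le ((integrableOn_delay (x := fun s => |D s|) hK hD.abs
    fun s hs => by rw [abs_abs]; exact hCd s hs).const_mul m)
    ((ae_restrict_iff' measurableSet_Ioi).2 (Eventually.of_forall fun u hu => ?_))
  have hu' : (0 : ℝ) < u := hu
  rw [← mul_sub, norm_mul, Real.norm_of_nonneg (hK0 u hu'.le), Real.norm_eq_abs]
  have := mul_le_mul_of_nonneg_left (h (t - u) (by linarith)) (hK0 u hu'.le)
  linarith

theorem continuous_delay (hK : IntegrableOn K (Set.Ioi 0)) (hx : Continuous x)
    (hC : ∀ s, |x s| ≤ C) : Continuous fun t => ∫ u in Set.Ioi (0 : ℝ), K u * x (t - u) := by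
  refine continuous_of_dominated (bound := fun u => ‖K u‖ * C)
    (fun t => (integrableOn_delay hK hx fun s _ => hC s).aestronglyMeasurable)
    (fun t => Eventually.of_forall fun u => ?_) (hK.norm.mul_const C)
    (Eventually.of_forall fun u => by fun_prop)
  rw [norm_mul]
  exact mul_le_mul_of_nonneg_left (hC _) (norm_nonneg _)

theorem tendsto_delay_zero (hK : IntegrableOn K (Set.Ioi 0)) (hx : Continuous x)
    (hC : ∀ s, |x s| ≤ C) (h0 : Tendsto x atTop (nhds 0)) :
    Tendsto (fun t => ∫ u in Set.Ioi (0 : ℝ), K u * x (t - u)) atTop (nhds 0) := by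
  have h := tendsto_integral_filter_of_dominated_convergence (μ := volume.restrict (Set.Ioi 0))
    (l := (atTop : Filter ℝ)) (F := fun t u => K u * x (t - u)) (f := fun _ => (0 : ℝ))
    (fun u => ‖K u‖ * C)
    (Eventually.of_forall fun t => (integrableOn_delay hK hx fun s _ => hC s).aestronglyMeasurable)
    (Eventually.of_forall fun t => Eventually.of_forall fun u => by
      rw [norm_mul]
      exact mul_le_mul_of_nonneg_left (hC _) (norm_nonneg _))
    (hK.norm.mul_const C)
    (Eventually.of_forall fun u => by
      have := (h0.comp (tendsto_atTop_add_const_right atTop (-u) tendsto_id)).const_mul (K u)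
      simpa [Function.comp_def, sub_eq_add_neg] using this)
  simpa using h

end Delay

section AbstractDynamics

variable {ι : Type*}

theorem exists_bound_Iic [Finite ι] {D : ι → ℝ → ℝ} {t₀ : ℝ} (hc : ∀ i, Continuous (D i))
    (hb : ∃ B, ∀ i, ∀ t ≤ t₀, |D i t| ≤ B) (T : ℝ) :
    ∃ B, 0 ≤ B ∧ ∀ i, ∀ t ≤ T, |D i t| ≤ B := by
  obtain ⟨B, hB⟩ := hb
  have h1 : ∀ i, ∃ b, ∀ t ∈ Set.Icc t₀ T, |D i t| ≤ b := fun i =>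
    isCompact_Icc.exists_bound_of_continuousOn (hc i).continuousOn
  choose b hb' using h1
  obtain ⟨M, hM⟩ := (Set.finite_range b).bddAbove
  refine ⟨max 0 (max B M), le_max_left _ _, fun i t ht => ?_⟩
  rcases le_total t t₀ with h | h
  · exact (hB i t h).trans ((le_max_left _ _).trans (le_max_right _ _))
  · exact (hb' i t ⟨h, ht⟩).trans ((hM ⟨i, rfl⟩).trans ((le_max_right _ _).trans (le_max_right _ _)))

/-- A Halanay-type criterion for systems with distributed infinite delay. -/
theorem tendsto_zero_of_delay_inequality [Finite ι] [Nonempty ι] {K : ι → ι → ℝ → ℝ}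
    (hK : ∀ i j, IntegrableOn (K i j) (Set.Ioi 0)) (hK0 : ∀ i j, ∀ u ≥ (0 : ℝ), 0 ≤ K i j u)
    (hK1 : ∀ i j, ∫ u in Set.Ioi (0 : ℝ), K i j u = 1) {lam δ t₀ : ℝ} (hδ : 0 < δ)
    (hδlam : δ ≤ lam) {D p : ι → ℝ → ℝ} {ε : ℝ → ℝ} (hε : Tendsto ε atTop (nhds 0))
    (hc : ∀ i, Continuous (D i)) (hb : ∃ B, ∀ i, ∀ t ≤ t₀, |D i t| ≤ B)
    (hD : ∀ i t, t₀ < t → HasDerivAt (D i) (-lam * D i t + p i t) t)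
    (hp : ∀ i t C, t₀ < t → 0 ≤ C → (∀ j, |D j t| ≤ C) →
      (∀ i j, ∫ u in Set.Ioi (0 : ℝ), K i j u * |D j (t - u)| ≤ C) →
      |p i t| ≤ (lam - δ) * C + ε t) (i : ι) :
    Tendsto (D i) atTop (nhds 0) := by
  have hlam : 0 < lam := hδ.trans_le hδlam
  have hbdd : ∃ B, 0 ≤ B ∧ ∀ i t, |D i t| ≤ B := by
    obtain ⟨t₁, ht₁⟩ := eventually_atTop.1
      ((hε.eventually_le_const one_pos).and (eventually_gt_atTop t₀))
    obtain ⟨B₁, hB₁0, hB₁⟩ := exists_bound_Iic hc hb t₁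
    refine ⟨(lam * B₁ + 1) / δ, by positivity, fun i T => ?_⟩
    set S : Set ℝ := {r | ∃ j, ∃ s ≤ T, r = |D j s|} with hS
    obtain ⟨BT, -, hBT⟩ := exists_bound_Iic hc hb T
    have hSb : BddAbove S := ⟨BT, by rintro _ ⟨j, s, hs, rfl⟩; exact hBT j s hs⟩
    have hle : ∀ j, ∀ s ≤ T, |D j s| ≤ sSup S := fun j s hs => le_csSup hSb ⟨j, s, hs, rfl⟩
    have hC0 : 0 ≤ sSup S := (abs_nonneg _).trans (hle i T le_rfl)
    have hP0 : 0 ≤ (lam - δ) * sSup S + 1 := by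
      have := mul_nonneg (sub_nonneg.2 hδlam) hC0
      linarith
    have hkey : sSup S ≤ B₁ + ((lam - δ) * sSup S + 1) / lam := by
      refine csSup_le ⟨_, i, T, le_rfl, rfl⟩ ?_
      rintro _ ⟨j, s, hs, rfl⟩
      rcases le_total s t₁ with h | h
      · have := hB₁ j s h
        have : 0 ≤ ((lam - δ) * sSup S + 1) / lam := by positivity
        linarith
      · have h1 := abs_le_exp_of_hasDerivAt (p := p j) hlam hP0 h (hc j)
          (fun t ht => hD j t ((ht₁ t₁ le_rfl).2.trans ht.1)) fun t ht => by
            have h2 := hp j t (sSup S) ((ht₁ t₁ le_rfl).2.trans ht.1) hC0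
              (fun k => hle k t (ht.2.le.trans hs))
              (fun i k => integral_delay_abs_le (hK i k) (hK0 i k) (hK1 i k) (hc k)
                fun r hr => hle k r (hr.trans (ht.2.le.trans hs)))
            have h3 := (ht₁ t ht.1.le).1
            linarith
        have h2 : Real.exp (-lam * (s - t₁)) ≤ 1 :=
          Real.exp_le_one_iff.2 (by nlinarith)
        have h3 := mul_le_mul h2 (hB₁ j t₁ le_rfl) (abs_nonneg _) zero_le_one
        linarith
    refine (hle i T le_rfl).trans ?_
    rw [le_div_iff₀ hδ]
    rw [← sub_le_iff_le_add', le_div_iff₀ hlam] at hkey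
    linarith
  obtain ⟨B, hB0, hB⟩ := hbdd
  have himp : ∀ C, 0 ≤ C → (∀ᶠ t in atTop, ∀ j, |D j t| ≤ C) → ∀ η > 0,
      ∀ᶠ t in atTop, ∀ j, |D j t| ≤ (1 - δ / lam) * C + η * (2 + 1 / lam) := by
    intro C hC0 hC η hη
    have hint : ∀ᶠ t in atTop, ∀ i j,
        ∫ u in Set.Ioi (0 : ℝ), K i j u * |D j (t - u)| ≤ C + η := by
      rw [eventually_all]; intro i
      rw [eventually_all]; intro j
      set g : ℝ → ℝ := fun s => max (|D j s| - C) 0 with hg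
      have hgc : Continuous g := ((hc j).abs.sub continuous_const).max continuous_const
      have hgb : ∀ s, |g s| ≤ B := fun s => by
        rw [abs_of_nonneg (le_max_right _ _)]
        exact max_le (by linarith [hB j s]) hB0
      have hg0 : Tendsto g atTop (nhds 0) := by
        refine tendsto_const_nhds.congr' ?_
        filter_upwards [hC] with t ht
        exact (max_eq_right (sub_nonpos.2 (ht j))).symm
      have h1 := tendsto_delay_zero (hK i j) hgc hgb hg0
      filter_upwards [h1.eventually_le_const hη] with t ht
      have h2 : ∫ u in Set.Ioi (0 : ℝ), K i j u * |D j (t - u)|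
          ≤ ∫ u in Set.Ioi (0 : ℝ), (K i j u * C + K i j u * g (t - u)) := by
        refine setIntegral_mono_on
          (integrableOn_delay (x := fun s => |D j s|) (C := B) (hK i j) (hc j).abs fun s _ => ?_)
          (((hK i j).mul_const C).add (integrableOn_delay (hK i j) hgc fun s _ => hgb s))
          measurableSet_Ioi fun u hu => ?_
        · rw [abs_abs]; exact hB j s
        · have hu' : (0 : ℝ) < u := hu
          rw [← mul_add]
          refine mul_le_mul_of_nonneg_left ?_ (hK0 i j u hu'.le)
          have := le_max_left (|D j (t - u)| - C) 0
          simp only [hg]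
          linarith
      rw [integral_add ((hK i j).mul_const C) (integrableOn_delay (hK i j) hgc fun s _ => hgb s),
        integral_mul_const, hK1, one_mul] at h2
      linarith
    obtain ⟨T, hT⟩ := eventually_atTop.1 (((hint.and hC).and (hε.eventually_le_const hη)).and
      (eventually_gt_atTop t₀))
    have hexp : Tendsto (fun t : ℝ => Real.exp (-(lam * (t - T))) * B) atTop (nhds (0 * B)) :=
      (Real.tendsto_exp_neg_atTop_nhds_zero.comp ((tendsto_atTop_add_const_right atTop (-T)
        tendsto_id).const_mul_atTop hlam)).mul_const B
    rw [zero_mul] at hexp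
    filter_upwards [hexp.eventually_le_const hη, eventually_ge_atTop T] with t ht htT j
    have hP0 : 0 ≤ (lam - δ) * (C + η) + η := by
      have := mul_nonneg (sub_nonneg.2 hδlam) (add_nonneg hC0 hη.le)
      linarith
    have h1 := abs_le_exp_of_hasDerivAt (p := p j) hlam hP0 htT (hc j)
      (fun s hs => hD j s ((hT T le_rfl).2.trans hs.1)) fun s hs => by
        obtain ⟨⟨⟨h2, h3⟩, h4⟩, h5⟩ := hT s hs.1.le
        have h6 := hp j s (C + η) h5 (by positivity) (fun k => (h3 k).trans (by linarith)) h2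
        linarith
    have h2 := mul_le_mul_of_nonneg_left (hB j T) (Real.exp_pos (-lam * (t - T))).le
    rw [← neg_mul] at ht
    have h3 : ((lam - δ) * (C + η) + η) / lam
        = (1 - δ / lam) * C + η * (1 + 1 / lam) - η * (δ / lam) := by
      field_simp; ring
    have h4 : 0 ≤ η * (δ / lam) := by positivity
    linarith
  set S : Set ℝ := {C | 0 ≤ C ∧ ∀ᶠ t in atTop, ∀ j, |D j t| ≤ C} with hS
  have hSb : BddBelow S := ⟨0, fun C hC => hC.1⟩
  have hSne : S.Nonempty := ⟨B, hB0, Eventually.of_forall fun t j => hB j t⟩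
  have hL0 : sInf S ≤ 0 := by
    by_contra! hpos
    have hκ : 0 < δ / lam := by positivity
    have hκ1 : δ / lam ≤ 1 := (div_le_one hlam).2 hδlam
    obtain ⟨C, hCS, hClt⟩ := exists_lt_of_csInf_lt hSne
      (show sInf S < sInf S + sInf S * (δ / lam) by nlinarith)
    have h1 : sInf S ≤ (1 - δ / lam) * C := by
      refine le_of_forall_pos_le_add fun η hη => ?_
      refine csInf_le hSb ⟨by have := hCS.1; have := sub_nonneg.2 hκ1; positivity, ?_⟩
      have h2 := himp C hCS.1 hCS.2 (η / (2 + 1 / lam)) (by positivity)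
      rwa [div_mul_cancel₀ _ (by positivity)] at h2
    have h2 := mul_le_mul_of_nonneg_left hClt.le (sub_nonneg.2 hκ1)
    nlinarith [mul_pos hpos (mul_pos hκ hκ)]
  rw [Metric.tendsto_nhds]
  intro η hη
  obtain ⟨C, hCS, hClt⟩ := exists_lt_of_csInf_lt hSne (hL0.trans_lt hη)
  filter_upwards [hCS.2] with t ht
  rw [Real.dist_eq, sub_zero]
  exact (ht i).trans_lt hClt

/-- A contractive forcing operator `N` produces a periodic solution of the linear equation with rate
`-lam` forced by `N`. -/
theorem exists_periodic_of_contraction [Fintype ι] {N : (ι → ℝ → ℝ) → ι → ℝ → ℝ}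
    {lam δ ω : ℝ} (hδ : 0 < δ) (hδlam : δ ≤ lam)
    (hNc : ∀ w : ι → ℝ → ℝ, (∀ i, Continuous (w i)) → (∃ C, ∀ i t, |w i t| ≤ C) →
      ∀ i, Continuous (N w i))
    (hN0 : ∃ P, ∀ i t, |N (fun _ _ => 0) i t| ≤ P)
    (hNL : ∀ w w' : ι → ℝ → ℝ, (∀ i, Continuous (w i)) → (∃ C, ∀ i t, |w i t| ≤ C) →
      (∀ i, Continuous (w' i)) → (∃ C, ∀ i t, |w' i t| ≤ C) → ∀ C, 0 ≤ C →
      (∀ i t, |w i t - w' i t| ≤ C) → ∀ i t, |N w i t - N w' i t| ≤ (lam - δ) * C)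
    (hNp : ∀ w i t, N (fun j s => w j (s + ω)) i t = N w i (t + ω)) :
    ∃ w : ι → ℝ → ℝ, (∃ C, ∀ i t, |w i t| ≤ C) ∧ (∀ i, Function.Periodic (w i) ω) ∧
      ∀ i t, HasDerivAt (w i) (-lam * w i t + N w i t) t := by
  have hlam : 0 < lam := hδ.trans_le hδlam
  let E := BoundedContinuousFunction ℝ (ι → ℝ)
  let co : E → ι → ℝ → ℝ := fun W i t => W t i
  have hcoc : ∀ W i, Continuous (co W i) := fun W i => (continuous_apply i).comp W.continuous
  have hcob : ∀ W : E, ∃ C, ∀ i t, |co W i t| ≤ C := fun W =>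
    ⟨‖W‖, fun i t => (norm_le_pi_norm (W t) i).trans (W.norm_coe_le_norm t)⟩
  have hsol : ∀ W : E, ∃ V : E, ∀ i t,
      HasDerivAt (co V i) (-lam * co V i t + N (co W) i t) t := by
    intro W
    obtain ⟨P, hP⟩ := hN0
    obtain ⟨C, hC⟩ := hcob W
    have hbd : ∀ i t, |N (co W) i t| ≤ (lam - δ) * max C 0 + P := fun i t => by
      have h1 := hNL (co W) (fun _ _ => 0) (hcoc W) (hcob W) (fun _ => continuous_const)
        ⟨0, by simp⟩ (max C 0) (le_max_right _ _)
        (fun i t => by rw [sub_zero]; exact (hC i t).trans (le_max_left _ _)) i t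
      have h2 := abs_add_le (N (co W) i t - N (fun _ _ => 0) i t) (N (fun _ _ => 0) i t)
      rw [sub_add_cancel] at h2
      linarith [hP i t]
    have h1 := fun i => exists_bounded_solution hlam (hNc _ (hcoc W) (hcob W) i) (hbd i)
    choose v hvb hvd using h1
    choose Cv hCv using hvb
    have hvc : Continuous fun t i => v i t :=
      continuous_pi fun i => continuous_iff_continuousAt.2 fun t => (hvd i t).continuousAt
    refine ⟨BoundedContinuousFunction.ofNormedAddCommGroup (fun t i => v i t) hvc
      (∑ i, |Cv i|) fun t => ?_, fun i t => hvd i t⟩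
    rw [pi_norm_le_iff_of_nonneg (Finset.sum_nonneg fun i _ => abs_nonneg _)]
    exact fun i => ((hCv i t).trans (le_abs_self _)).trans
      (Finset.single_le_sum (f := fun i => |Cv i|) (fun i _ => abs_nonneg _) (Finset.mem_univ i))
  have hcomp : ∀ V V' W W' : E,
      (∀ i t, HasDerivAt (co V i) (-lam * co V i t + N (co W) i t) t) →
      (∀ i t, HasDerivAt (co V' i) (-lam * co V' i t + N (co W') i t) t) →
      dist V V' ≤ (lam - δ) / lam * dist W W' := by
    intro V V' W W' hV hV'
    have hr : 0 ≤ (lam - δ) / lam := div_nonneg (sub_nonneg.2 hδlam) hlam.le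
    rw [BoundedContinuousFunction.dist_le (by positivity)]
    intro t
    rw [dist_pi_le_iff (by positivity)]
    intro i
    obtain ⟨C, hC⟩ := hcob V
    obtain ⟨C', hC'⟩ := hcob V'
    have h1 := abs_le_div_of_hasDerivAt (D := fun t => co V i t - co V' i t)
      (p := fun t => N (co W) i t - N (co W') i t) (C := C + C') (P := (lam - δ) * dist W W') hlam
      (fun t => (abs_sub _ _).trans (add_le_add (hC i t) (hC' i t)))
      (fun t => ((hV i t).sub (hV' i t)).congr_deriv (by ring))
      (hNL _ _ (hcoc W) (hcob W) (hcoc W') (hcob W') _ dist_nonneg (fun j s =>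
        (dist_le_pi_dist (W s) (W' s) j).trans (BoundedContinuousFunction.dist_coe_le_dist s)) i) t
    rw [div_mul_eq_mul_div]
    exact h1
  choose F hF using hsol
  obtain ⟨r, hr⟩ : ∃ r : NNReal, (r : ℝ) = (lam - δ) / lam :=
    ⟨⟨_, div_nonneg (sub_nonneg.2 hδlam) hlam.le⟩, rfl⟩
  have hcontr : ContractingWith r F := by
    refine ⟨?_, LipschitzWith.of_dist_le_mul fun W W' => ?_⟩
    · rw [← NNReal.coe_lt_coe, hr, NNReal.coe_one, div_lt_one hlam]
      linarith
    · rw [hr]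
      exact hcomp _ _ _ _ (hF W) (hF W')
  set W := ContractingWith.fixedPoint F hcontr with hW
  have hfix : F W = W := hcontr.fixedPoint_isFixedPt
  have hWd : ∀ i t, HasDerivAt (co W i) (-lam * co W i t + N (co W) i t) t := by
    have := hF W
    rwa [hfix] at this
  let Z : E := W.compContinuous ⟨fun t => t + ω, by fun_prop⟩
  have hZd : ∀ i t, HasDerivAt (co Z i) (-lam * co Z i t + N (co Z) i t) t := fun i t => by
    have h1 : N (co Z) i t = N (co W) i (t + ω) := hNp (co W) i t
    rw [h1]
    exact (hWd i (t + ω)).comp_add_const t ω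
  have hZ : Z = W := by
    refine hcontr.fixedPoint_unique ?_
    have := hcomp _ _ _ _ (hF Z) hZd
    rw [dist_self, mul_zero] at this
    exact dist_le_zero.1 this
  exact ⟨co W, hcob W, fun i t => congrFun (DFunLike.congr_fun hZ t) i, hWd⟩

end AbstractDynamics

section NetworkInput

variable {ι : Type*} [Fintype ι]

/-- The input received by one neuron, as a function of the current activities `p` and the delayed
activities `q`. -/
noncomputable def networkInput (ρ : ι → ℝ) (f : ι → ℝ → ℝ) (c d : ι → ℝ) (e : ι → ι → ℝ) (J : ℝ)
    (p q : ι → ℝ) : ℝ :=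
  (∑ j, c j * f j (ρ j * p j)) + (∑ j, d j * f j (ρ j * q j))
    + (∑ j, ∑ l, e j l * f j (ρ j * q j) * f l (ρ l * q l)) + J

theorem abs_sum_sub_sum_le {g h r : ι → ℝ} (H : ∀ j, |g j - h j| ≤ r j) :
    |∑ j, g j - ∑ j, h j| ≤ ∑ j, r j := by
  rw [← Finset.sum_sub_distrib]
  exact (Finset.abs_sum_le_sum_abs _ _).trans (Finset.sum_le_sum fun j _ => H j)

theorem abs_networkInput_sub_le {ρ M μ : ι → ℝ} {f : ι → ℝ → ℝ} (hρ : ∀ j, 0 < ρ j)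
    (hμ : ∀ j, 0 < μ j) (hfμ : ∀ j u v, |f j u - f j v| ≤ μ j * |u - v|)
    (hfM : ∀ j u, |f j u| ≤ M j) (c d : ι → ℝ) (e : ι → ι → ℝ) (J : ℝ) {p q p' q' m : ι → ℝ}
    (hp : ∀ j, |p j - p' j| ≤ m j) (hq : ∀ j, |q j - q' j| ≤ m j) :
    |networkInput ρ f c d e J p q - networkInput ρ f c d e J p' q'| ≤
      ∑ j, ((|c j| + |d j|) * μ j * ρ j * m j
        + ∑ l, |e j l| * (m j * M l * μ j * ρ j + m l * M j * μ l * ρ l)) := by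
  have hf : ∀ j (r s : ℝ), |r - s| ≤ m j → |f j (ρ j * r) - f j (ρ j * s)| ≤ μ j * ρ j * m j :=
    fun j r s h => by
      refine (hfμ j _ _).trans ?_
      rw [← mul_sub, abs_mul, abs_of_pos (hρ j), mul_assoc]
      have := hρ j
      have := hμ j
      gcongr
  have h1 : |∑ j, c j * f j (ρ j * p j) - ∑ j, c j * f j (ρ j * p' j)|
      ≤ ∑ j, |c j| * (μ j * ρ j * m j) := abs_sum_sub_sum_le fun j => by
    rw [← mul_sub, abs_mul]
    exact mul_le_mul_of_nonneg_left (hf j _ _ (hp j)) (abs_nonneg _)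
  have h2 : |∑ j, d j * f j (ρ j * q j) - ∑ j, d j * f j (ρ j * q' j)|
      ≤ ∑ j, |d j| * (μ j * ρ j * m j) := abs_sum_sub_sum_le fun j => by
    rw [← mul_sub, abs_mul]
    exact mul_le_mul_of_nonneg_left (hf j _ _ (hq j)) (abs_nonneg _)
  have h3 : |∑ j, ∑ l, e j l * f j (ρ j * q j) * f l (ρ l * q l)
      - ∑ j, ∑ l, e j l * f j (ρ j * q' j) * f l (ρ l * q' l)|
      ≤ ∑ j, ∑ l, |e j l| * (m j * M l * μ j * ρ j + m l * M j * μ l * ρ l) :=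
    abs_sum_sub_sum_le fun j => abs_sum_sub_sum_le fun l => by
      rw [mul_assoc, mul_assoc, ← mul_sub, abs_mul]
      refine mul_le_mul_of_nonneg_left ?_ (abs_nonneg _)
      have e1 : f j (ρ j * q j) * f l (ρ l * q l) - f j (ρ j * q' j) * f l (ρ l * q' l)
          = (f j (ρ j * q j) - f j (ρ j * q' j)) * f l (ρ l * q l)
            + f j (ρ j * q' j) * (f l (ρ l * q l) - f l (ρ l * q' l)) := by ring
      rw [e1]
      refine (abs_add_le _ _).trans ?_
      rw [abs_mul, abs_mul]
      have hj := hf j _ _ (hq j)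
      have hl := hf l _ _ (hq l)
      have k1 := mul_le_mul hj (hfM l (ρ l * q l)) (abs_nonneg _) ((abs_nonneg _).trans hj)
      have k2 := mul_le_mul (hfM j (ρ j * q' j)) hl (abs_nonneg _)
        ((abs_nonneg _).trans (hfM j (ρ j * q' j)))
      linarith
  have h4 : ∑ j, ((|c j| + |d j|) * μ j * ρ j * m j
        + ∑ l, |e j l| * (m j * M l * μ j * ρ j + m l * M j * μ l * ρ l))
      = (∑ j, |c j| * (μ j * ρ j * m j)) + (∑ j, |d j| * (μ j * ρ j * m j))
        + ∑ j, ∑ l, |e j l| * (m j * M l * μ j * ρ j + m l * M j * μ l * ρ l) := by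
    rw [← Finset.sum_add_distrib, ← Finset.sum_add_distrib]
    exact Finset.sum_congr rfl fun j _ => by ring
  rw [h4, abs_le]
  rw [abs_le] at h1 h2 h3
  unfold networkInput
  constructor <;> linarith

theorem abs_networkInput_coeff_sub_le {ρ M : ι → ℝ} {f : ι → ℝ → ℝ} (hfM : ∀ j u, |f j u| ≤ M j)
    (c d c' d' : ι → ℝ) (e e' : ι → ι → ℝ) (J J' : ℝ) (p q : ι → ℝ) :
    |networkInput ρ f c' d' e' J' p q - networkInput ρ f c d e J p q| ≤
      (∑ j, |c j - c' j| * M j) + (∑ j, |d j - d' j| * M j)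
        + (∑ j, ∑ l, |e j l - e' j l| * (M j * M l)) + |J - J'| := by
  have h1 : |∑ j, c' j * f j (ρ j * p j) - ∑ j, c j * f j (ρ j * p j)|
      ≤ ∑ j, |c j - c' j| * M j := abs_sum_sub_sum_le fun j => by
    rw [← sub_mul, abs_mul, abs_sub_comm]
    exact mul_le_mul_of_nonneg_left (hfM _ _) (abs_nonneg _)
  have h2 : |∑ j, d' j * f j (ρ j * q j) - ∑ j, d j * f j (ρ j * q j)|
      ≤ ∑ j, |d j - d' j| * M j := abs_sum_sub_sum_le fun j => by
    rw [← sub_mul, abs_mul, abs_sub_comm]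
    exact mul_le_mul_of_nonneg_left (hfM _ _) (abs_nonneg _)
  have h3 : |∑ j, ∑ l, e' j l * f j (ρ j * q j) * f l (ρ l * q l)
      - ∑ j, ∑ l, e j l * f j (ρ j * q j) * f l (ρ l * q l)|
      ≤ ∑ j, ∑ l, |e j l - e' j l| * (M j * M l) :=
    abs_sum_sub_sum_le fun j => abs_sum_sub_sum_le fun l => by
      rw [mul_assoc, mul_assoc, ← sub_mul, abs_mul, abs_sub_comm, abs_mul]
      have := (abs_nonneg _).trans (hfM j (ρ j * q j))
      have := hfM j (ρ j * q j)
      have := hfM l (ρ l * q l)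
      gcongr
  have h4 : |J' - J| ≤ |J - J'| := (abs_sub_comm _ _).le
  rw [abs_le] at h1 h2 h3 h4 ⊢
  unfold networkInput
  constructor <;> linarith

end NetworkInput

theorem Mrhs_eq_networkInput (n : ℕ) (ρc : Fin (n+1) → ℝ) (a b : Fin (n+1) → ℝ → ℝ)
    (c d : Fin (n+1) → Fin (n+1) → ℝ → ℝ) (e : Fin (n+1) → Fin (n+1) → Fin (n+1) → ℝ → ℝ)
    (I : Fin (n+1) → ℝ → ℝ) (f : Fin (n+1) → ℝ → ℝ) (K : Fin (n+1) → Fin (n+1) → ℝ → ℝ)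
    (x : Fin (n+1) → ℝ → ℝ) (i : Fin (n+1)) (t : ℝ) :
    Mrhs n ρc a b c d e I f K x i t = a i (x i t) * (-(b i (x i t))
      + networkInput ρc f (fun j => c i j t) (fun j => d i j t) (fun j l => e i j l t) (I i t)
        (fun j => x j t) (fun j => ∫ u in Set.Ioi (0:ℝ), K i j u * x j (t - u))) := by
  unfold Mrhs networkInput
  ring

/-- Corollary 4.6: all solutions of the asymptotic model (M̂) converge to an
ω-periodic solution of the periodic model (M). -/
theorem M_convergence_to_periodic_solution {n : ℕ} (ω : ℝ) (hω : 0 < ω)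
    (ρc : Fin (n+1) → ℝ) (a b : Fin (n+1) → ℝ → ℝ)
    (c d : Fin (n+1) → Fin (n+1) → ℝ → ℝ) (e : Fin (n+1) → Fin (n+1) → Fin (n+1) → ℝ → ℝ)
    (I : Fin (n+1) → ℝ → ℝ) (f : Fin (n+1) → ℝ → ℝ) (K : Fin (n+1) → Fin (n+1) → ℝ → ℝ)
    (aL aU β βs M μ : Fin (n+1) → ℝ)
    (hreg : MRegular n ρc a b c d e I f K)
    (hass : MAssumptions n ω ρc a b c d e I f aL aU β βs M μ)
    (dv : Fin (n+1) → ℝ) (hdv : ∀ i, 0 < dv i)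
    (hdom : ∀ i, ∀ t ∈ Set.Icc (0:ℝ) ω,
      (∑ j : Fin (n+1),
        ((|c i j t| + |d i j t|) * μ j * ρc j * (dv j / dv i)
          + ∑ l : Fin (n+1), |e i j l t| *
            ((dv j / dv i) * M l * μ j * ρc j + (dv l / dv i) * M j * μ l * ρc l)))
        < β i)
    (ch dh : Fin (n+1) → Fin (n+1) → ℝ → ℝ) (eh : Fin (n+1) → Fin (n+1) → Fin (n+1) → ℝ → ℝ)
    (Ih : Fin (n+1) → ℝ → ℝ)
    (hregh : MRegular n ρc a b ch dh eh Ih f K)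
    (hcconv : ∀ i j, Tendsto (fun t => c i j t - ch i j t) atTop (nhds 0))
    (hdconv : ∀ i j, Tendsto (fun t => d i j t - dh i j t) atTop (nhds 0))
    (heconv : ∀ i j l, Tendsto (fun t => e i j l t - eh i j l t) atTop (nhds 0))
    (hIconv : ∀ i, Tendsto (fun t => I i t - Ih i t) atTop (nhds 0))
    (dw : Fin (n+1) → ℝ) (hdw : ∀ i, 0 < dw i)
    (hdom2 : ∀ i, ∀ t ∈ Set.Icc (0:ℝ) ω,
      (∑ j : Fin (n+1),
        ((|c i j t| + |d i j t|) * μ j * ρc j * aU j * (dw j / dw i)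
          + ∑ l : Fin (n+1), |e i j l t| *
            ((dw j / dw i) * aU j * M l * μ j * ρc j
              + (dw l / dw i) * aU l * M j * μ l * ρc l)))
        < aL i * β i) :
    ∃ xper : Fin (n+1) → ℝ → ℝ,
      (∀ i, Continuous (xper i)) ∧
      (∀ i, ∀ t : ℝ, xper i (t + ω) = xper i t) ∧
      (∀ i, ∀ t : ℝ, 0 < t →
        HasDerivAt (xper i) (Mrhs n ρc a b c d e I f K xper i t) t) ∧
      (∀ t₀ : ℝ, 0 ≤ t₀ → ∀ y : Fin (n+1) → ℝ → ℝ,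
        MIsSolution n ρc a b ch dh eh Ih f K t₀ y →
        Tendsto (fun t => Finset.univ.sup' Finset.univ_nonempty
          (fun i => |y i t - xper i t|)) atTop (nhds 0)) := by
  obtain ⟨hρ, ha, -, hb, hc, hd, he, hI, hf, -, hK0, hK1⟩ := hreg
  obtain ⟨hcp, hdp, hep, hIp, haL, haLU, hab, hβ, hβs, hslope, hM, hμ, hfμ, hfM⟩ := hass
  have hK : ∀ i j, IntegrableOn (K i j) (Set.Ioi 0) := fun i j =>
    integrable_of_integral_eq_one (hK1 i j)
  have haU : ∀ i, 0 < aU i := fun i => (haL i).trans_le (haLU i)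
  have hββs : ∀ i, β i ≤ βs i := fun i => by
    have := hslope i 1 0 one_ne_zero
    exact this.1.trans this.2
  choose A φ hφA hAφ hAd hφd using fun i => exists_inverse_primitive (ha i) (haL i) (hab i)
  have hφc : ∀ i, Continuous (φ i) := fun i =>
    continuous_iff_continuousAt.2 fun u => (hφd i u).continuousAt
  have hAc : ∀ i, Continuous (A i) := fun i =>
    continuous_iff_continuousAt.2 fun u => (hAd i u).continuousAt
  have hφl : ∀ i u v, |φ i u - φ i v| ≤ aU i * |u - v| := fun i =>
    abs_sub_le_of_slope (haL i) (hab i) (hφd i)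
  have hφb : ∀ j (g : ℝ → ℝ) (s : Set ℝ), (∃ C, ∀ t ∈ s, |g t| ≤ C) →
      ∃ C, ∀ t ∈ s, |φ j (dw j * g t)| ≤ C := by
    rintro j g s ⟨C, hC⟩
    refine ⟨aU j * (dw j * C) + |φ j 0|, fun t ht => ?_⟩
    have h1 := hφl j (dw j * g t) 0
    rw [sub_zero, abs_mul, abs_of_pos (hdw j)] at h1
    have h2 : aU j * (dw j * |g t|) ≤ aU j * (dw j * C) :=
      mul_le_mul_of_nonneg_left (mul_le_mul_of_nonneg_left (hC t ht) (hdw j).le) (haU j).le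
    have h3 := abs_sub_abs_le_abs_sub (φ j (dw j * g t)) (φ j 0)
    linarith
  choose c' hc'c hc'p hc'e using fun i j => exists_periodic_extension hω (hc i j) (hcp i j)
  choose d' hd'c hd'p hd'e using fun i j => exists_periodic_extension hω (hd i j) (hdp i j)
  choose e' he'c he'p he'e using fun i j l => exists_periodic_extension hω (he i j l) (hep i j l)
  choose I' hI'c hI'p hI'e using fun i => exists_periodic_extension hω (hI i) (hIp i)
  obtain ⟨S, hS⟩ : ∃ S : Fin (n+1) → ℝ → ℝ, ∀ i t, S i t = ∑ j : Fin (n+1),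
      ((|c' i j t| + |d' i j t|) * μ j * ρc j * aU j * (dw j / dw i)
        + ∑ l : Fin (n+1), |e' i j l t| * ((dw j / dw i) * aU j * M l * μ j * ρc j
            + (dw l / dw i) * aU l * M j * μ l * ρc l)) := ⟨_, fun _ _ => rfl⟩
  have hSc : ∀ i, Continuous (S i) := fun i => by
    rw [funext (hS i)]
    fun_prop
  have hSp : ∀ i, Function.Periodic (S i) ω := fun i t => by
    rw [hS, hS]
    simp only [hc'p _ _ t, hd'p _ _ t, he'p _ _ _ t]
  obtain ⟨δ, hδ, hSδ⟩ := exists_uniform_gap (B := fun i => aL i * β i) hω hSc hSp fun i t ht => by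
    rw [hS]
    simp only [hc'e _ _ t ht.1, hd'e _ _ t ht.1, he'e _ _ _ t ht.1]
    exact hdom2 i t ht
  obtain ⟨lam, hlam⟩ : ∃ lam, ∀ i, aU i * βs i ≤ lam :=
    ⟨∑ i, aU i * βs i, fun i => Finset.single_le_sum (f := fun i => aU i * βs i)
      (fun i _ => (mul_pos (haU i) (hβs i)).le) (Finset.mem_univ i)⟩
  have hlamβ : ∀ i, aL i * β i ≤ lam := fun i =>
    (mul_le_mul (haLU i) (hββs i) (hβ i).le (haU i).le).trans (hlam i)
  have hδlam : δ ≤ lam := by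
    have h1 : 0 ≤ S 0 0 := by
      rw [hS]
      refine Finset.sum_nonneg fun j _ => add_nonneg ?_ (Finset.sum_nonneg fun l _ => ?_)
      · have := hμ j; have := hρ j; have := haU j; have := hdw j; have := hdw 0
        positivity
      · have := hμ j; have := hρ j; have := haU j; have := hdw j; have := hdw 0; have := hM j
        have := hμ l; have := hρ l; have := haU l; have := hdw l; have := hM l
        positivity
    have h2 := hSδ 0 0
    have h3 := hlamβ 0
    linarith
  obtain ⟨G, hG⟩ : ∃ G : (Fin (n+1) → ℝ → ℝ) → Fin (n+1) → ℝ → ℝ, ∀ w i t, G w i t =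
      networkInput ρc f (fun j => c' i j t) (fun j => d' i j t) (fun j l => e' i j l t) (I' i t)
        (fun j => φ j (dw j * w j t))
        (fun j => ∫ u in Set.Ioi (0:ℝ), K i j u * φ j (dw j * w j (t - u))) :=
    ⟨_, fun _ _ _ => rfl⟩
  obtain ⟨N, hN⟩ : ∃ N : (Fin (n+1) → ℝ → ℝ) → Fin (n+1) → ℝ → ℝ, ∀ w i t, N w i t =
      lam * w i t + (-(b i (φ i (dw i * w i t))) + G w i t) / dw i := ⟨_, fun _ _ _ => rfl⟩
  have hloc : ∀ (w w' : Fin (n+1) → ℝ → ℝ) t, (∀ i, Continuous (w i)) → (∀ i, Continuous (w' i)) →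
      (∃ C, ∀ i, ∀ s ≤ t, |w i s| ≤ C) → (∃ C, ∀ i, ∀ s ≤ t, |w' i s| ≤ C) → ∀ C, 0 ≤ C →
      (∀ j, |w j t - w' j t| ≤ C) →
      (∀ i j, ∫ u in Set.Ioi (0:ℝ), K i j u * |w j (t - u) - w' j (t - u)| ≤ C) →
      ∀ i, |N w i t - N w' i t| ≤ (lam - δ) * C := by
    rintro w w' t hw hw' ⟨B, hB⟩ ⟨B', hB'⟩ C hC0 hC hCK i
    have hdi := hdw i
    have hm : ∀ j (r s : ℝ), |φ j (dw j * r) - φ j (dw j * s)| ≤ aU j * dw j * |r - s| :=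
      fun j r s => by
        refine (hφl j _ _).trans_eq ?_
        rw [← mul_sub, abs_mul, abs_of_pos (hdw j), mul_assoc]
    have haUd : ∀ j, 0 ≤ aU j * dw j := fun j => (mul_pos (haU j) (hdw j)).le
    have hGle : |G w i t - G w' i t| ≤ (aL i * β i - δ) * (dw i * C) := by
      rw [hG, hG]
      refine (abs_networkInput_sub_le (m := fun j => aU j * dw j * C) hρ hμ hfμ hfM _ _ _ _
        (fun j => (hm j _ _).trans (mul_le_mul_of_nonneg_left (hC j) (haUd j)))
        (fun j => ?_)).trans ?_
      · refine (abs_delay_sub_le (x := fun s => φ j (dw j * w j s))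
          (y := fun s => φ j (dw j * w' j s)) (D := fun s => w j s - w' j s) (hK i j) (hK0 i j)
          ((hφc j).comp (continuous_const.mul (hw j))) ((hφc j).comp (continuous_const.mul (hw' j)))
          ((hw j).sub (hw' j)) (hφb j (w j) (Set.Iic t) ⟨B, hB j⟩)
          (hφb j (w' j) (Set.Iic t) ⟨B', hB' j⟩)
          ⟨B + B', fun s hs => (abs_sub _ _).trans (add_le_add (hB j s hs) (hB' j s hs))⟩
          fun s _ => hm j _ _).trans ?_
        exact mul_le_mul_of_nonneg_left (hCK i j) (haUd j)
      · refine le_trans (le_of_eq ?_)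
          (mul_le_mul_of_nonneg_right (hSδ i t) (mul_nonneg hdi.le hC0))
        rw [hS, Finset.sum_mul]
        refine Finset.sum_congr rfl fun j _ => ?_
        conv_rhs => rw [add_mul, Finset.sum_mul]
        congr 1
        · field_simp
        · refine Finset.sum_congr rfl fun l _ => ?_
          field_simp
    have hble := abs_mul_sub_comp_le (haL i) (hab i) (hφd i) (hβ i) (hslope i) (hlam i)
      (dw i * w i t) (dw i * w' i t)
    rw [← mul_sub (dw i), abs_mul (dw i), abs_of_pos hdi] at hble
    have hble' := hble.trans (mul_le_mul_of_nonneg_left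
      (mul_le_mul_of_nonneg_left (hC i) hdi.le) (sub_nonneg.2 (hlamβ i)))
    have hdiff : N w i t - N w' i t = (lam * (dw i * (w i t - w' i t))
        - (b i (φ i (dw i * w i t)) - b i (φ i (dw i * w' i t))) + (G w i t - G w' i t)) / dw i := by
      rw [hN, hN]
      field_simp
      ring
    rw [hdiff, abs_div, abs_of_pos hdi, div_le_iff₀ hdi]
    refine (abs_add_le _ _).trans ?_
    linarith
  have hNc : ∀ w : Fin (n+1) → ℝ → ℝ, (∀ i, Continuous (w i)) → (∃ C, ∀ i t, |w i t| ≤ C) →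
      ∀ i, Continuous (N w i) := by
    rintro w hw ⟨C, hC⟩ i
    have h1 : ∀ j, Continuous fun t => ∫ u in Set.Ioi (0:ℝ), K i j u * φ j (dw j * w j (t - u)) :=
      fun j => by
        obtain ⟨B, hB⟩ := hφb j (w j) Set.univ ⟨C, fun t _ => hC j t⟩
        exact continuous_delay (x := fun s => φ j (dw j * w j s)) (hK i j) (by fun_prop)
          fun s => hB s trivial
    rw [funext (hN w i)]
    simp only [hG, networkInput]
    fun_prop
  have hNp : ∀ w i t, N (fun j s => w j (s + ω)) i t = N w i (t + ω) := by
    intro w i t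
    rw [hN, hN, hG, hG]
    simp only [hc'p _ _ t, hd'p _ _ t, he'p _ _ _ t, hI'p _ t, sub_add_eq_add_sub]
  have hN0 : ∃ P, ∀ i t, |N (fun _ _ => 0) i t| ≤ P := by
    have h1 : ∀ i, ∃ P, ∀ t, |N (fun _ _ => 0) i t| ≤ P := fun i => by
      have h2 : Function.Periodic (N (fun _ _ => 0) i) ω := fun t => (hNp (fun _ _ => 0) i t).symm
      obtain ⟨P, hP⟩ := isBounded_iff_forall_norm_le.1 (h2.isBounded_of_continuous hω.ne'
        (hNc _ (fun _ => continuous_const) ⟨0, by simp⟩ i))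
      exact ⟨P, fun t => hP _ ⟨t, rfl⟩⟩
    choose P hP using h1
    obtain ⟨Q, hQ⟩ := (Set.finite_range P).bddAbove
    exact ⟨Q, fun i t => (hP i t).trans (hQ ⟨i, rfl⟩)⟩
  obtain ⟨w, ⟨B, hwB⟩, hwp, hwd⟩ := exists_periodic_of_contraction hδ hδlam hNc hN0
    (fun v v' hv hvb hv' hvb' C hC0 hC i t => by
      obtain ⟨Bv, hBv⟩ := hvb
      obtain ⟨Bv', hBv'⟩ := hvb'
      exact hloc v v' t hv hv' ⟨Bv, fun i s _ => hBv i s⟩ ⟨Bv', fun i s _ => hBv' i s⟩ C hC0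
        (fun j => hC j t) (fun i j => integral_delay_abs_le (x := fun s => v j s - v' j s) (hK i j)
          (hK0 i j) (hK1 i j) ((hv j).sub (hv' j)) fun s _ => hC j s) i) hNp
  have hwc : ∀ i, Continuous (w i) := fun i =>
    continuous_iff_continuousAt.2 fun t => (hwd i t).continuousAt
  refine ⟨fun i t => φ i (dw i * w i t), fun i => (hφc i).comp (continuous_const.mul (hwc i)),
    fun i t => by simp only [hwp i t], fun i t ht => ?_, fun t₀ ht₀ y hy => ?_⟩
  · refine ((hφd i _).comp t ((hwd i t).const_mul (dw i))).congr_deriv ?_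
    rw [Mrhs_eq_networkInput, hN, hG]
    simp only [hc'e _ _ t ht.le, hd'e _ _ t ht.le, he'e _ _ _ t ht.le, hI'e _ t ht.le]
    have := (hdw i).ne'
    field_simp
    ring
  obtain ⟨hyc, ⟨By, hBy⟩, hyd⟩ := hy
  obtain ⟨v, hv⟩ : ∃ v : Fin (n+1) → ℝ → ℝ, ∀ i t, v i t = A i (y i t) / dw i :=
    ⟨_, fun _ _ => rfl⟩
  have hφv : ∀ i t, φ i (dw i * v i t) = y i t := fun i t => by
    rw [hv, mul_div_cancel₀ _ (hdw i).ne', hφA]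
  have hvc : ∀ i, Continuous (v i) := fun i => by
    rw [funext (hv i)]
    exact ((hAc i).comp (hyc i)).div_const _
  have hvb : ∃ C, ∀ i, ∀ t ≤ t₀, |v i t| ≤ C := by
    have h1 : ∀ i, ∃ C, ∀ r ∈ Set.Icc (-By) By, |A i r / dw i| ≤ C := fun i =>
      isCompact_Icc.exists_bound_of_continuousOn ((hAc i).div_const _).continuousOn
    choose C hC using h1
    obtain ⟨Q, hQ⟩ := (Set.finite_range C).bddAbove
    refine ⟨Q, fun i t ht => ?_⟩
    rw [hv]
    exact (hC i _ (abs_le.1 (hBy i t ht))).trans (hQ ⟨i, rfl⟩)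
  obtain ⟨Gh, hGh⟩ : ∃ Gh : Fin (n+1) → ℝ → ℝ, ∀ i t, Gh i t =
      networkInput ρc f (fun j => ch i j t) (fun j => dh i j t) (fun j l => eh i j l t) (Ih i t)
        (fun j => y j t) (fun j => ∫ u in Set.Ioi (0:ℝ), K i j u * y j (t - u)) :=
    ⟨_, fun _ _ => rfl⟩
  have hvd : ∀ i t, t₀ < t →
      HasDerivAt (v i) (-lam * v i t + (N v i t + (Gh i t - G v i t) / dw i)) t := by
    intro i t ht
    rw [funext (hv i)]
    refine (((hAd i _).comp t (hyd i t ht)).div_const (dw i)).congr_deriv ?_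
    have h1 : a i (y i t) ≠ 0 := ((haL i).trans_le (hab i _).1).ne'
    have h2 := (hdw i).ne'
    change _ = -lam * (A i (y i t) / dw i) + _
    rw [Mrhs_eq_networkInput, ← hGh, hN, hφv, ← hv i t, inv_mul_cancel_left₀ h1]
    field_simp
    ring
  obtain ⟨E, hE⟩ : ∃ E : Fin (n+1) → ℝ → ℝ, ∀ i t, E i t =
      ((∑ j, |c i j t - ch i j t| * M j) + (∑ j, |d i j t - dh i j t| * M j)
        + (∑ j, ∑ l, |e i j l t - eh i j l t| * (M j * M l)) + |I i t - Ih i t|) / dw i :=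
    ⟨_, fun _ _ => rfl⟩
  have hE0 : ∀ i t, 0 ≤ E i t := fun i t => by
    rw [hE]
    refine div_nonneg (add_nonneg (add_nonneg (add_nonneg (Finset.sum_nonneg fun j _ => ?_)
      (Finset.sum_nonneg fun j _ => ?_)) (Finset.sum_nonneg fun j _ => Finset.sum_nonneg
        fun l _ => ?_)) (abs_nonneg _)) (hdw i).le
    · exact mul_nonneg (abs_nonneg _) (hM j).le
    · exact mul_nonneg (abs_nonneg _) (hM j).le
    · exact mul_nonneg (abs_nonneg _) (mul_pos (hM j) (hM l)).le
  have hElim : ∀ i, Tendsto (E i) atTop (nhds 0) := fun i => by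
    rw [funext (hE i)]
    have h1 := (((tendsto_finsetSum Finset.univ fun j _ => (hcconv i j).abs.mul_const (M j)).add
      (tendsto_finsetSum Finset.univ fun j _ => (hdconv i j).abs.mul_const (M j))).add
      (tendsto_finsetSum Finset.univ fun j _ => tendsto_finsetSum Finset.univ fun l _ =>
        (heconv i j l).abs.mul_const (M j * M l))).add (hIconv i).abs
    simpa using h1.div_const (dw i)
  have hGE : ∀ i t, t₀ < t → |(Gh i t - G v i t) / dw i| ≤ E i t := fun i t ht => by
    have ht0 : 0 ≤ t := ht₀.trans ht.le
    rw [abs_div, abs_of_pos (hdw i), hE]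
    refine div_le_div_of_nonneg_right ?_ (hdw i).le
    rw [hGh, hG]
    simp only [hφv, hc'e _ _ t ht0, hd'e _ _ t ht0, he'e _ _ _ t ht0, hI'e _ t ht0]
    exact abs_networkInput_coeff_sub_le hfM _ _ _ _ _ _ _ _ _ _
  have hεlim : Tendsto (fun t => ∑ i, E i t) atTop (nhds 0) := by
    simpa using tendsto_finsetSum Finset.univ fun i _ => hElim i
  have hDlim : ∀ i, Tendsto (fun t => v i t - w i t) atTop (nhds 0) := by
    refine tendsto_zero_of_delay_inequality (D := fun i t => v i t - w i t)
      (p := fun i t => N v i t - N w i t + (Gh i t - G v i t) / dw i) hK hK0 hK1 hδ hδlam hεlim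
      (fun i => (hvc i).sub (hwc i)) ?_
      (fun i t ht => ((hvd i t ht).sub (hwd i t)).congr_deriv (by ring)) ?_
    · obtain ⟨C, hC⟩ := hvb
      exact ⟨C + B, fun i t ht => (abs_sub _ _).trans (add_le_add (hC i t ht) (hwB i t))⟩
    · intro i t C ht hC0 hC hCK
      obtain ⟨Bv, -, hBv⟩ := exists_bound_Iic hvc hvb t
      have h1 := hloc v w t hvc hwc ⟨Bv, hBv⟩ ⟨B, fun i s _ => hwB i s⟩ C hC0 hC hCK i
      have h2 := Finset.single_le_sum (f := fun i => E i t) (fun i _ => hE0 i t)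
        (Finset.mem_univ i)
      exact (abs_add_le _ _).trans (add_le_add h1 ((hGE i t ht).trans h2))
  have hsum : Tendsto (fun t => ∑ i, aU i * (dw i * |v i t - w i t|)) atTop (nhds 0) := by
    simpa using tendsto_finsetSum Finset.univ fun i _ =>
      ((hDlim i).abs.const_mul (dw i)).const_mul (aU i)
  refine squeeze_zero (fun t => ?_) (fun t => ?_) hsum
  · exact (abs_nonneg _).trans (Finset.le_sup' (fun i => |y i t - φ i (dw i * w i t)|)
      (Finset.mem_univ 0))
  · refine Finset.sup'_le _ _ fun i _ => ?_
    refine le_trans ?_ (Finset.single_le_sum (f := fun i => aU i * (dw i * |v i t - w i t|))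
      (fun i _ => mul_nonneg (haU i).le (mul_nonneg (hdw i).le (abs_nonneg _)))
      (Finset.mem_univ i))
    have h1 := hφl i (dw i * v i t) (dw i * w i t)
    rwa [hφv, ← mul_sub, abs_mul, abs_of_pos (hdw i)] at h1
end

section
/- Let x = (x₁,x₂) : ℝ → ℝ² be continuous, bounded on (−∞,0], differentiable on (0,∞) and satisfying system (E) for all t > 0, and let x̂ = (x̂₁,x̂₂) : ℝ → ℝ² be continuous, bounded on (−∞,0], differentiable on (0,∞) and satisfying system (Ê) for all t > 0. Then lim_{t→+∞} max(|x₁(t) − x̂₁(t)|, |x₂(t) − x̂₂(t)|) = 0. -/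
open Filter Real

/-- Right-hand side of the first equation of system (E). -/
noncomputable def E1rhs (x1 x2 : ℝ → ℝ) (t : ℝ) : ℝ :=
  (Real.sin (x1 t) + 2) *
    (-((4 + Real.exp (-t)) * x1 t * Real.exp (Real.sin (x1 t) / (1 + (x1 t) ^ 2)))
      + ((1 / 3) * Real.cos t + Real.exp (-t)) * Real.tanh (x2 (t - |Real.sin t|))
      + Real.exp (Real.sin t) + Real.exp (-t))

/-- Right-hand side of the second equation of system (E). -/
noncomputable def E2rhs (x1 x2 : ℝ → ℝ) (t : ℝ) : ℝ :=
  (Real.cos (x2 t) + 2) *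
    (-((5 + Real.cos t + Real.exp (-t)) * x2 t)
      + ((2 / 3) * Real.sin t + Real.exp (-t)) * Real.tanh (x1 (t - |Real.cos t|))
      + Real.cos t + Real.exp (-t))

/-- Right-hand side of the first equation of the asymptotic system (Ê). -/
noncomputable def Eh1rhs (y1 y2 : ℝ → ℝ) (t : ℝ) : ℝ :=
  (Real.sin (y1 t) + 2) *
    (-(4 * y1 t * Real.exp (Real.sin (y1 t) / (1 + (y1 t) ^ 2)))
      + (1 / 3) * Real.cos t * Real.tanh (y2 (t - |Real.sin t|))
      + Real.exp (Real.sin t))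

/-- Right-hand side of the second equation of the asymptotic system (Ê). -/
noncomputable def Eh2rhs (y1 y2 : ℝ → ℝ) (t : ℝ) : ℝ :=
  (Real.cos (y2 t) + 2) *
    (-((5 + Real.cos t) * y2 t)
      + (2 / 3) * Real.sin t * Real.tanh (y1 (t - |Real.cos t|))
      + Real.cos t)

theorem abs_tanh_le_one (x : ℝ) : |Real.tanh x| ≤ 1 := by
  have h := Real.tanh_bijOn.mapsTo (Set.mem_univ x)
  exact abs_le.2 ⟨h.1.le, h.2.le⟩

theorem hasDerivAt_tanh_inv_cosh_sq (x : ℝ) :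
    HasDerivAt Real.tanh (1 / Real.cosh x ^ 2) x := by
  have h : Real.tanh = fun y => Real.sinh y / Real.cosh y := funext Real.tanh_eq_sinh_div_cosh
  rw [h]
  refine ((Real.hasDerivAt_sinh x).div (Real.hasDerivAt_cosh x)
    (Real.cosh_pos x).ne').congr_deriv ?_
  rw [← Real.cosh_sq_sub_sinh_sq x]
  ring

theorem abs_sub_le_of_deriv_mem_Icc {f f' : ℝ → ℝ} (hf : ∀ x, HasDerivAt f (f' x) x)
    (h0 : ∀ x, 0 ≤ f' x) (h1 : ∀ x, f' x ≤ 1) (x y : ℝ) : |f x - f y| ≤ |x - y| := by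
  have hd : Differentiable ℝ f := fun x => (hf x).differentiableAt
  have key : ∀ u v, u ≤ v → |f v - f u| ≤ |v - u| := fun u v huv => by
    have hl := mul_sub_le_image_sub_of_le_deriv hd (C := 0)
      (fun x => by rw [(hf x).deriv]; exact h0 x) huv
    have hu := image_sub_le_mul_sub_of_deriv_le hd (C := 1)
      (fun x => by rw [(hf x).deriv]; exact h1 x) huv
    rw [abs_of_nonneg (by linarith), abs_of_nonneg (by linarith)]
    linarith
  rcases le_total x y with h | h
  · rw [abs_sub_comm, abs_sub_comm x]
    exact key x y h
  · exact key y x h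

theorem abs_tanh_sub_tanh_le (x y : ℝ) : |Real.tanh x - Real.tanh y| ≤ |x - y| := by
  refine abs_sub_le_of_deriv_mem_Icc hasDerivAt_tanh_inv_cosh_sq (fun x => by positivity)
    (fun x => ?_) x y
  have h := Real.one_le_cosh x
  exact div_le_one_of_le₀ (by nlinarith) (by positivity)

/-- The state-dependent nonlinearity of the first equation. -/
noncomputable def expDamping (x : ℝ) : ℝ := x * Real.exp (Real.sin x / (1 + x ^ 2))

theorem abs_div_one_add_sq_le (x : ℝ) : |x / (1 + x ^ 2)| ≤ 1 / 2 := by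
  have h : 0 < 1 + x ^ 2 := by positivity
  rw [abs_div, abs_of_pos h, div_le_div_iff₀ h two_pos]
  nlinarith [sq_nonneg (|x| - 1), sq_abs x]

theorem abs_sin_div_one_add_sq_le (x : ℝ) : |Real.sin x / (1 + x ^ 2)| ≤ 1 / 2 := by
  refine le_trans ?_ (abs_div_one_add_sq_le x)
  rw [abs_div, abs_div]
  exact div_le_div_of_nonneg_right Real.abs_sin_le_abs (abs_nonneg _)

theorem hasDerivAt_expDamping (x : ℝ) :
    HasDerivAt expDamping (Real.exp (Real.sin x / (1 + x ^ 2)) *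
      (1 + (x / (1 + x ^ 2) * Real.cos x - 2 * (x / (1 + x ^ 2)) ^ 2 * Real.sin x))) x := by
  have h : 1 + x ^ 2 ≠ 0 := by positivity
  have hs := (Real.hasDerivAt_sin x).div (((hasDerivAt_id x).pow 2).const_add 1) h
  refine ((hasDerivAt_id x).mul hs.exp).congr_deriv ?_
  simp only [id, Pi.div_apply, Pi.pow_apply]
  field_simp
  ring

theorem three_fifths_le_exp {s : ℝ} (hs : -(1 / 2) ≤ s) : 3 / 5 ≤ Real.exp s := by
  have h1 : Real.exp (-(1 / 2)) * Real.exp (-(1 / 2)) * Real.exp 1 = 1 := by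
    rw [← Real.exp_add, ← Real.exp_add]; norm_num
  have h2 := Real.exp_one_lt_d9
  have h3 := Real.exp_le_exp.2 hs
  have h4 := Real.exp_pos (-(1 / 2))
  by_contra! h
  have h5 : Real.exp (-(1 / 2)) * Real.exp (-(1 / 2)) < 9 / 25 := by nlinarith
  nlinarith [Real.exp_pos 1]

theorem expDamping_sub_ge {u v : ℝ} (h : v ≤ u) :
    1 / 6 * (u - v) ≤ expDamping u - expDamping v := by
  refine mul_sub_le_image_sub_of_le_deriv
    (fun x => (hasDerivAt_expDamping x).differentiableAt) (fun x => ?_) h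
  rw [(hasDerivAt_expDamping x).deriv]
  have he := three_fifths_le_exp (abs_le.1 (abs_sin_div_one_add_sq_le x)).1
  have hp := abs_le.1 (abs_div_one_add_sq_le x)
  set p := x / (1 + x ^ 2)
  have hp2 : p ^ 2 ≤ 1 / 4 := by nlinarith
  have hsq : (p * Real.cos x - 2 * p ^ 2 * Real.sin x) ^ 2 ≤ 1 / 2 := by
    have hsum : (p * Real.cos x - 2 * p ^ 2 * Real.sin x) ^ 2
        + (p * Real.sin x + 2 * p ^ 2 * Real.cos x) ^ 2 = p ^ 2 + 4 * (p ^ 2) ^ 2 := by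
      linear_combination (p ^ 2 + 4 * p ^ 4) * Real.sin_sq_add_cos_sq x
    nlinarith [sq_nonneg (p * Real.sin x + 2 * p ^ 2 * Real.cos x), sq_nonneg p]
  have hq : -(71 / 100) ≤ p * Real.cos x - 2 * p ^ 2 * Real.sin x := by
    by_contra! hlt
    nlinarith
  nlinarith

theorem abs_expDamping_le (x : ℝ) : |expDamping x| ≤ 3 * |x| := by
  rw [expDamping, abs_mul, abs_of_pos (Real.exp_pos _), mul_comm]
  refine mul_le_mul_of_nonneg_right ?_ (abs_nonneg x)
  have h := (abs_le.1 (abs_sin_div_one_add_sq_le x)).2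
  have h1 : Real.exp (Real.sin x / (1 + x ^ 2)) ≤ Real.exp 1 := Real.exp_le_exp.2 (by linarith)
  linarith [Real.exp_one_lt_d9]

theorem eventually_le_of_deriv_le_neg {z z' : ℝ → ℝ} {r δ : ℝ} (hδ : 0 < δ)
    (hz : ∀ᶠ t in atTop, HasDerivAt z (z' t) t)
    (hneg : ∀ᶠ t in atTop, r ≤ z t → z' t ≤ -δ) : ∀ᶠ t in atTop, z t ≤ r := by
  obtain ⟨T, hT⟩ := eventually_atTop.1 (hz.and hneg)
  obtain ⟨a, haT, ha⟩ : ∃ a ≥ T, z a ≤ r := by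
    by_contra! hgt
    have hle : ∀ t ≥ T, z t - z T ≤ -δ * (t - T) := fun t ht =>
      (convex_Ici T).image_sub_le_mul_sub_of_deriv_le
        (fun s hs => (hT s hs).1.continuousAt.continuousWithinAt)
        (fun s hs => (hT s (interior_subset hs)).1.differentiableAt.differentiableWithinAt)
        (fun s hs => by
          have hs' := interior_subset hs
          rw [(hT s hs').1.deriv]
          exact (hT s hs').2 (hgt s hs').le) T Set.self_mem_Ici t ht ht
    have hpos : 0 ≤ (z T - r) / δ := div_nonneg (by linarith [hgt T le_rfl]) hδ.le
    have h1 := hle (T + (z T - r) / δ) (by linarith)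
    have h2 := hgt (T + (z T - r) / δ) (by linarith)
    have h3 : δ * ((z T - r) / δ) = z T - r := mul_div_cancel₀ _ hδ.ne'
    nlinarith
  filter_upwards [eventually_ge_atTop a] with b hb
  exact image_le_of_deriv_right_lt_deriv_boundary (f := z) (f' := z') (a := a) (b := b)
    (B := fun _ => r) (B' := fun _ => 0)
    (fun s hs => (hT s (haT.trans hs.1)).1.continuousAt.continuousWithinAt)
    (fun s hs => (hT s (haT.trans hs.1)).1.hasDerivWithinAt) ha
    (fun s => hasDerivAt_const s r)
    (fun s hs heq => by
      have := (hT s (haT.trans hs.1)).2 heq.ge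
      linarith) ⟨hb, le_rfl⟩

/-- A positive speed factor `g` with values in `[1, 3]` is removed by the change of variable
`G = ∫ 1 / g`, after which the dissipation `F` dominates the forcing `p - q`. -/
theorem eventually_sub_le_of_dissipative {g : ℝ → ℝ} (hg : Continuous g) (hg1 : ∀ u, 1 ≤ g u)
    (hg3 : ∀ u, g u ≤ 3) {F : ℝ → ℝ → ℝ} {m : ℝ} (hm : 0 < m)
    (hF : ∀ t u v, v ≤ u → m * (u - v) ≤ F t u - F t v) {x y p q : ℝ → ℝ}
    (hx : ∀ᶠ t in atTop, HasDerivAt x (g (x t) * (-F t (x t) + p t)) t)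
    (hy : ∀ᶠ t in atTop, HasDerivAt y (g (y t) * (-F t (y t) + q t)) t) {K r : ℝ}
    (hpq : ∀ᶠ t in atTop, p t - q t ≤ K) (hr : 0 ≤ r) (hK : K < m * r) :
    ∀ᶠ t in atTop, x t - y t ≤ 3 * r := by
  have hg0 : ∀ u, g u ≠ 0 := fun u => (zero_lt_one.trans_le (hg1 u)).ne'
  set G : ℝ → ℝ := fun u => ∫ s in (0 : ℝ)..u, (g s)⁻¹
  have hG : ∀ u, HasDerivAt G ((g u)⁻¹) u := fun u =>
    ((hg.inv₀ hg0).integral_hasStrictDerivAt 0 u).hasDerivAt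
  have hGd : Differentiable ℝ G := fun u => (hG u).differentiableAt
  have hGlow : ∀ u v, v ≤ u → 1 / 3 * (u - v) ≤ G u - G v := fun u v h =>
    mul_sub_le_image_sub_of_le_deriv hGd (fun s => by
      rw [(hG s).deriv, one_div]
      exact inv_anti₀ (by linarith [hg1 s]) (hg3 s)) h
  have hGup : ∀ u v, v ≤ u → G u - G v ≤ 1 * (u - v) := fun u v h =>
    image_sub_le_mul_sub_of_deriv_le hGd (fun s => by
      rw [(hG s).deriv]
      exact inv_le_one_of_one_le₀ (hg1 s)) h
  have hz : ∀ᶠ t in atTop, HasDerivAt (fun t => G (x t) - G (y t))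
      ((-F t (x t) + p t) - (-F t (y t) + q t)) t := by
    filter_upwards [hx, hy] with t hxt hyt
    refine (((hG (x t)).comp t hxt).sub ((hG (y t)).comp t hyt)).congr_deriv ?_
    rw [inv_mul_cancel_left₀ (hg0 _), inv_mul_cancel_left₀ (hg0 _)]
  have hmain : ∀ᶠ t in atTop, G (x t) - G (y t) ≤ r := by
    refine eventually_le_of_deriv_le_neg (sub_pos.2 hK) hz ?_
    filter_upwards [hpq] with t ht hrt
    have hxy : y t ≤ x t := by
      by_contra! hlt
      linarith [hGlow _ _ hlt.le]
    have h1 := hGup _ _ hxy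
    have h2 := hF t _ _ hxy
    nlinarith
  filter_upwards [hmain] with t ht
  rcases le_total (y t) (x t) with h | h
  · linarith [hGlow _ _ h]
  · linarith

theorem eventually_abs_sub_le_of_dissipative {g : ℝ → ℝ} (hg : Continuous g)
    (hg1 : ∀ u, 1 ≤ g u) (hg3 : ∀ u, g u ≤ 3) {F : ℝ → ℝ → ℝ} {m : ℝ} (hm : 0 < m)
    (hF : ∀ t u v, v ≤ u → m * (u - v) ≤ F t u - F t v) {x y p q : ℝ → ℝ}
    (hx : ∀ᶠ t in atTop, HasDerivAt x (g (x t) * (-F t (x t) + p t)) t)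
    (hy : ∀ᶠ t in atTop, HasDerivAt y (g (y t) * (-F t (y t) + q t)) t) {K r : ℝ}
    (hpq : ∀ᶠ t in atTop, |p t - q t| ≤ K) (hr : 0 ≤ r) (hK : K < m * r) :
    ∀ᶠ t in atTop, |x t - y t| ≤ 3 * r := by
  have h1 := eventually_sub_le_of_dissipative hg hg1 hg3 hm hF hx hy
    (hpq.mono fun t ht => (abs_le.1 ht).2) hr hK
  have h2 := eventually_sub_le_of_dissipative hg hg1 hg3 hm hF hy hx
    (hpq.mono fun t ht => by linarith [(abs_le.1 ht).1]) hr hK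
  filter_upwards [h1, h2] with t h1 h2
  exact abs_le.2 ⟨by linarith, h1⟩

/-- Solutions with bounded forcing are ultimately bounded, by comparison with the zero
solution. -/
theorem exists_eventually_abs_le_of_dissipative {g : ℝ → ℝ} (hg : Continuous g)
    (hg1 : ∀ u, 1 ≤ g u) (hg3 : ∀ u, g u ≤ 3) {F : ℝ → ℝ → ℝ} {m : ℝ} (hm : 0 < m)
    (hF : ∀ t u v, v ≤ u → m * (u - v) ≤ F t u - F t v) (hF0 : ∀ t, F t 0 = 0)
    {x p : ℝ → ℝ} (hx : ∀ᶠ t in atTop, HasDerivAt x (g (x t) * (-F t (x t) + p t)) t) {K : ℝ}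
    (hp : ∀ᶠ t in atTop, |p t| ≤ K) : ∃ D, ∀ᶠ t in atTop, |x t| ≤ D := by
  refine ⟨3 * ((|K| + 1) / m), ?_⟩
  have h := eventually_abs_sub_le_of_dissipative hg hg1 hg3 hm hF (y := fun _ => 0)
    (q := fun _ => 0) hx
    (Eventually.of_forall fun t => by simpa [hF0] using hasDerivAt_const t (0 : ℝ))
    (hp.mono fun t ht => by simpa using ht) (r := (|K| + 1) / m) (by positivity)
    (by rw [mul_div_cancel₀ _ hm.ne']; linarith [le_abs_self K])
  simpa using h

theorem tendsto_sub_atTop_of_abs_le_one {τ : ℝ → ℝ} (hτ : ∀ t, |τ t| ≤ 1) :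
    Tendsto (fun t => t - |τ t|) atTop atTop :=
  tendsto_atTop_mono (fun t => by rw [id]; linarith [hτ t])
    (tendsto_atTop_add_const_right atTop (-1 : ℝ) tendsto_id)

theorem one_le_sin_add_two (u : ℝ) : 1 ≤ Real.sin u + 2 := by linarith [Real.neg_one_le_sin u]

theorem sin_add_two_le_three (u : ℝ) : Real.sin u + 2 ≤ 3 := by linarith [Real.sin_le_one u]

theorem one_le_cos_add_two (u : ℝ) : 1 ≤ Real.cos u + 2 := by linarith [Real.neg_one_le_cos u]

theorem cos_add_two_le_three (u : ℝ) : Real.cos u + 2 ≤ 3 := by linarith [Real.cos_le_one u]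

theorem abs_mul_tanh_le {a C : ℝ} (ha : |a| ≤ C) (w : ℝ) : |a * Real.tanh w| ≤ C := by
  rw [abs_mul]
  nlinarith [abs_tanh_le_one w, abs_nonneg a, abs_nonneg (Real.tanh w)]

theorem mul_expDamping_sub_ge {a u v : ℝ} (ha : 4 ≤ a) (h : v ≤ u) :
    2 / 3 * (u - v) ≤ a * expDamping u - a * expDamping v := by
  nlinarith [expDamping_sub_ge h]

theorem abs_mul_tanh_sub_le {a C w w' b : ℝ} (ha : |a| ≤ C) (hw : |w - w'| ≤ b) :
    |a * (Real.tanh w - Real.tanh w')| ≤ C * b := by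
  rw [abs_mul]
  exact mul_le_mul ha ((abs_tanh_sub_tanh_le w w').trans hw) (abs_nonneg _)
    ((abs_nonneg a).trans ha)

theorem eventually_exp_neg_mul_le {f : ℝ → ℝ} {D ε : ℝ} (hf : ∀ᶠ t in atTop, |f t| ≤ D)
    (hε : 0 < ε) : ∀ᶠ t in atTop, |Real.exp (-t) * f t| ≤ ε := by
  have h := (Real.tendsto_exp_neg_atTop_nhds_zero.mul_const D)
  rw [zero_mul] at h
  filter_upwards [h.eventually (gt_mem_nhds hε), hf] with t ht hft
  rw [abs_mul, abs_of_pos (Real.exp_pos _)]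
  exact (mul_le_mul_of_nonneg_left hft (Real.exp_pos _).le).trans ht.le

theorem tendsto_zero_of_eventually_le_contraction {f : ℝ → ℝ} {c D : ℝ}
    (hc0 : 0 < c) (hc1 : c < 1) (hD : ∀ᶠ t in atTop, |f t| ≤ D)
    (hstep : ∀ b > 0, (∀ᶠ t in atTop, |f t| ≤ b) → ∀ᶠ t in atTop, |f t| ≤ c * b) :
    Tendsto f atTop (nhds 0) := by
  have hpow : ∀ n : ℕ, ∀ᶠ t in atTop, |f t| ≤ c ^ n * (|D| + 1) := by
    intro n
    induction n with
    | zero => exact hD.mono fun t ht => by linarith [le_abs_self D]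
    | succ k ih =>
      refine (hstep _ (by positivity) ih).mono fun t ht => ?_
      rwa [pow_succ', mul_assoc]
  have hlim := (tendsto_pow_atTop_nhds_zero_of_lt_one hc0.le hc1).mul_const (|D| + 1)
  rw [zero_mul] at hlim
  rw [Metric.tendsto_nhds]
  intro ε hε
  obtain ⟨n, hn⟩ := (hlim.eventually (gt_mem_nhds hε)).exists
  filter_upwards [hpow n] with t ht
  rw [Real.dist_eq, sub_zero]
  exact ht.trans_lt hn

/-- Example 5.1: every solution of system (E) converges to every solution of its
asymptotic system (Ê). -/
theorem example_system_convergence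
    (x1 x2 y1 y2 : ℝ → ℝ)
    (hx1c : Continuous x1) (hx2c : Continuous x2)
    (hxbd : ∃ M, ∀ t ≤ (0:ℝ), |x1 t| ≤ M ∧ |x2 t| ≤ M)
    (hx1d : ∀ t : ℝ, 0 < t → HasDerivAt x1 (E1rhs x1 x2 t) t)
    (hx2d : ∀ t : ℝ, 0 < t → HasDerivAt x2 (E2rhs x1 x2 t) t)
    (hy1c : Continuous y1) (hy2c : Continuous y2)
    (hybd : ∃ M, ∀ t ≤ (0:ℝ), |y1 t| ≤ M ∧ |y2 t| ≤ M)
    (hy1d : ∀ t : ℝ, 0 < t → HasDerivAt y1 (Eh1rhs y1 y2 t) t)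
    (hy2d : ∀ t : ℝ, 0 < t → HasDerivAt y2 (Eh2rhs y1 y2 t) t) :
    Tendsto (fun t => max |x1 t - y1 t| |x2 t - y2 t|) atTop (nhds 0) := by
  have hpos := eventually_gt_atTop (0 : ℝ)
  have hgs : Continuous fun u : ℝ => Real.sin u + 2 := by fun_prop
  have hgc : Continuous fun u : ℝ => Real.cos u + 2 := by fun_prop
  have hexp : ∀ t : ℝ, 0 < t → |Real.exp (-t)| ≤ 1 := fun t ht => by
    rw [abs_of_pos (Real.exp_pos _)]
    exact Real.exp_le_one_iff.2 (by linarith)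
  have hcos4 : ∀ t : ℝ, 4 ≤ 5 + Real.cos t := fun t => by linarith [Real.neg_one_le_cos t]
  have hx1b : ∃ D, ∀ᶠ t in atTop, |x1 t| ≤ D := by
    refine exists_eventually_abs_le_of_dissipative hgs one_le_sin_add_two sin_add_two_le_three
      (F := fun t u => (4 + Real.exp (-t)) * expDamping u)
      (p := fun t => (1 / 3 * Real.cos t + Real.exp (-t)) * Real.tanh (x2 (t - |Real.sin t|))
        + Real.exp (Real.sin t) + Real.exp (-t)) (m := 2 / 3) (K := 6) (by norm_num)
      (fun t u v h => mul_expDamping_sub_ge (by linarith [Real.exp_pos (-t)]) h)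
      (fun t => by simp [expDamping]) ?_ ?_
    · filter_upwards [hpos] with t ht
      refine (hx1d t ht).congr_deriv ?_
      simp only [E1rhs, expDamping]
      ring
    · filter_upwards [hpos] with t ht
      have he := abs_le.1 (hexp t ht)
      have ha : |1 / 3 * Real.cos t + Real.exp (-t)| ≤ 2 := abs_le.2
        ⟨by linarith [Real.neg_one_le_cos t], by linarith [Real.cos_le_one t]⟩
      have h := abs_le.1 (abs_mul_tanh_le ha (x2 (t - |Real.sin t|)))
      have hs := Real.exp_le_exp.2 (Real.sin_le_one t)
      have hs0 := Real.exp_pos (Real.sin t)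
      have h1 := Real.exp_one_lt_d9
      exact abs_le.2 ⟨by linarith, by linarith⟩
  have hx2b : ∃ D, ∀ᶠ t in atTop, |x2 t| ≤ D := by
    refine exists_eventually_abs_le_of_dissipative hgc one_le_cos_add_two cos_add_two_le_three
      (F := fun t u => (5 + Real.cos t + Real.exp (-t)) * u)
      (p := fun t => (2 / 3 * Real.sin t + Real.exp (-t)) * Real.tanh (x1 (t - |Real.cos t|))
        + Real.cos t + Real.exp (-t)) (m := 4) (K := 6) (by norm_num)
      (fun t u v h => by nlinarith [hcos4 t, Real.exp_pos (-t)])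
      (fun t => by simp) ?_ ?_
    · filter_upwards [hpos] with t ht
      refine (hx2d t ht).congr_deriv ?_
      simp only [E2rhs]
      ring
    · filter_upwards [hpos] with t ht
      have he := abs_le.1 (hexp t ht)
      have ha : |2 / 3 * Real.sin t + Real.exp (-t)| ≤ 2 := abs_le.2
        ⟨by linarith [Real.neg_one_le_sin t], by linarith [Real.sin_le_one t]⟩
      have h := abs_le.1 (abs_mul_tanh_le ha (x1 (t - |Real.cos t|)))
      have hc := abs_le.1 (Real.abs_cos_le_one t)
      exact abs_le.2 ⟨by linarith, by linarith⟩
  have hy2b : ∃ D, ∀ᶠ t in atTop, |y2 t| ≤ D := by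
    refine exists_eventually_abs_le_of_dissipative hgc one_le_cos_add_two cos_add_two_le_three
      (F := fun t u => (5 + Real.cos t) * u)
      (p := fun t => 2 / 3 * Real.sin t * Real.tanh (y1 (t - |Real.cos t|)) + Real.cos t)
      (m := 4) (K := 2) (by norm_num) (fun t u v h => by nlinarith [hcos4 t])
      (fun t => by simp) ?_ (Eventually.of_forall fun t => ?_)
    · filter_upwards [hpos] with t ht
      refine (hy2d t ht).congr_deriv ?_
      simp only [Eh2rhs]
      ring
    · have ha : |2 / 3 * Real.sin t| ≤ 1 := abs_le.2
        ⟨by linarith [Real.neg_one_le_sin t], by linarith [Real.sin_le_one t]⟩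
      have h := abs_le.1 (abs_mul_tanh_le ha (y1 (t - |Real.cos t|)))
      have hc := abs_le.1 (Real.abs_cos_le_one t)
      exact abs_le.2 ⟨by linarith, by linarith⟩
  obtain ⟨D1, hD1⟩ := hx1b
  obtain ⟨D2, hD2⟩ := hx2b
  obtain ⟨D3, hD3⟩ := hy2b
  have hpert1 : ∀ᶠ t in atTop,
      |Real.tanh (x2 (t - |Real.sin t|)) + 1 - expDamping (x1 t)| ≤ 2 + 3 * D1 := by
    filter_upwards [hD1] with t ht
    have h1 := abs_le.1 (abs_tanh_le_one (x2 (t - |Real.sin t|)))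
    have h2 := abs_le.1 (abs_expDamping_le (x1 t))
    exact abs_le.2 ⟨by linarith, by linarith⟩
  have hpert2 : ∀ᶠ t in atTop,
      |Real.tanh (x1 (t - |Real.cos t|)) + 1 - x2 t| ≤ 2 + D2 := by
    filter_upwards [hD2] with t ht
    have h1 := abs_le.1 (abs_tanh_le_one (x1 (t - |Real.cos t|)))
    have h2 := abs_le.1 ht
    exact abs_le.2 ⟨by linarith, by linarith⟩
  have hstep1 : ∀ b > 0, (∀ᶠ t in atTop, |x2 t - y2 t| ≤ b) →
      ∀ᶠ t in atTop, |x1 t - y1 t| ≤ 8 / 5 * b := by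
    intro b hb h
    have hdelay := (tendsto_sub_atTop_of_abs_le_one Real.abs_sin_le_one).eventually h
    have hsmall := eventually_exp_neg_mul_le hpert1 (ε := b / 90) (by positivity)
    have := eventually_abs_sub_le_of_dissipative hgs one_le_sin_add_two sin_add_two_le_three
      (F := fun _ u => 4 * expDamping u) (m := 2 / 3) (by norm_num)
      (fun _ u v huv => mul_expDamping_sub_ge le_rfl huv) (x := x1) (y := y1)
      (p := fun t => 1 / 3 * Real.cos t * Real.tanh (x2 (t - |Real.sin t|))
        + Real.exp (Real.sin t)
        + Real.exp (-t) * (Real.tanh (x2 (t - |Real.sin t|)) + 1 - expDamping (x1 t)))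
      (q := fun t => 1 / 3 * Real.cos t * Real.tanh (y2 (t - |Real.sin t|))
        + Real.exp (Real.sin t)) (K := 1 / 3 * b + b / 90) (r := 8 / 15 * b)
      (hpos.mono fun t ht => (hx1d t ht).congr_deriv (by simp only [E1rhs, expDamping]; ring))
      (hpos.mono fun t ht => (hy1d t ht).congr_deriv (by simp only [Eh1rhs, expDamping]; ring))
      (by
        filter_upwards [hdelay, hsmall] with t ht hst
        have ha : |1 / 3 * Real.cos t| ≤ 1 / 3 := abs_le.2
          ⟨by linarith [Real.neg_one_le_cos t], by linarith [Real.cos_le_one t]⟩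
        have h1 := abs_le.1 (abs_mul_tanh_sub_le ha ht)
        have h2 := abs_le.1 hst
        exact abs_le.2 ⟨by linarith, by linarith⟩)
      (by positivity) (by linarith)
    filter_upwards [this] with t ht
    linarith
  have hstep2 : ∀ b > 0, (∀ᶠ t in atTop, |x1 t - y1 t| ≤ b) →
      ∀ᶠ t in atTop, |x2 t - y2 t| ≤ 9 / 16 * b := by
    intro b hb h
    have hdelay := (tendsto_sub_atTop_of_abs_le_one Real.abs_cos_le_one).eventually h
    have hsmall := eventually_exp_neg_mul_le hpert2 (ε := b / 24) (by positivity)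
    have := eventually_abs_sub_le_of_dissipative hgc one_le_cos_add_two cos_add_two_le_three
      (F := fun t u => (5 + Real.cos t) * u) (m := 4) (by norm_num)
      (fun t u v huv => by nlinarith [hcos4 t]) (x := x2) (y := y2)
      (p := fun t => 2 / 3 * Real.sin t * Real.tanh (x1 (t - |Real.cos t|)) + Real.cos t
        + Real.exp (-t) * (Real.tanh (x1 (t - |Real.cos t|)) + 1 - x2 t))
      (q := fun t => 2 / 3 * Real.sin t * Real.tanh (y1 (t - |Real.cos t|)) + Real.cos t)
      (K := 2 / 3 * b + b / 24) (r := 3 / 16 * b)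
      (hpos.mono fun t ht => (hx2d t ht).congr_deriv (by simp only [E2rhs]; ring))
      (hpos.mono fun t ht => (hy2d t ht).congr_deriv (by simp only [Eh2rhs]; ring))
      (by
        filter_upwards [hdelay, hsmall] with t ht hst
        have ha : |2 / 3 * Real.sin t| ≤ 2 / 3 := abs_le.2
          ⟨by linarith [Real.neg_one_le_sin t], by linarith [Real.sin_le_one t]⟩
        have h1 := abs_le.1 (abs_mul_tanh_sub_le ha ht)
        have h2 := abs_le.1 hst
        exact abs_le.2 ⟨by linarith, by linarith⟩)
      (by positivity) (by linarith)
    filter_upwards [this] with t ht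
    linarith
  have hbound2 : ∀ᶠ t in atTop, |x2 t - y2 t| ≤ D2 + D3 := by
    filter_upwards [hD2, hD3] with t h2 h3
    exact (abs_sub _ _).trans (add_le_add h2 h3)
  have hlim2 : Tendsto (fun t => x2 t - y2 t) atTop (nhds 0) :=
    tendsto_zero_of_eventually_le_contraction (c := 9 / 10) (by norm_num) (by norm_num) hbound2
      fun b hb h => (hstep2 _ (by positivity) (hstep1 b hb h)).mono fun t ht => by linarith
  have hlim1 : Tendsto (fun t => x1 t - y1 t) atTop (nhds 0) := by
    rw [Metric.tendsto_nhds]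
    intro ε hε
    have h2 : ∀ᶠ t in atTop, |x2 t - y2 t| ≤ ε / 2 :=
      (Metric.tendsto_nhds.1 hlim2 (ε / 2) (by positivity)).mono fun t ht => by
        rw [Real.dist_eq, sub_zero] at ht
        exact ht.le
    filter_upwards [hstep1 _ (by positivity) h2] with t ht
    rw [Real.dist_eq, sub_zero]
    linarith
  simpa using hlim1.abs.max hlim2.abs
end
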